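/- arXiv:2403.01959 — 2 statements merged into one kernel-verified Lean document; each statement's English description precedes it below -/
import Mathlib

section
/- Let N ≥ 1, α ∈ ℝ and q ≥ 1 satisfy 1 ≤ q ≤ (N+1)/N and β := α − 1 + ((q−1)/q)(N+1) > −1/q. Then there exists a constant C > 0 such that for every u ∈ C_c^∞(cl(ℝ^{N+1}_+)) one has (∫_{ℝ^{N+1}_+} y^{βq} |u(x,y)|^q dx dy)^{1/q} ≤ C ∫_{ℝ^{N+1}_+} y^{α} |∇u(x,y)| dx dy. -/
open MeasureTheory Real

noncomputable section

/-- The upper half-space `ℝ^{N+1}_+`. -/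
def HS (N : ℕ) : Set ((Fin N → ℝ) × ℝ) := {z | 0 < z.2}

/-- Partial derivative of `u` in the `i`-th `x` direction. -/
def pX {N : ℕ} (u : ((Fin N → ℝ) × ℝ) → ℝ) (i : Fin N) (z : (Fin N → ℝ) × ℝ) : ℝ :=
  fderiv ℝ u z (Pi.single i 1, 0)

/-- Partial derivative of `u` in the `y` direction. -/
def pY {N : ℕ} (u : ((Fin N → ℝ) × ℝ) → ℝ) (z : (Fin N → ℝ) × ℝ) : ℝ :=
  fderiv ℝ u z (0, 1)

/-- Euclidean norm of the full gradient `∇u`. -/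
def gradNorm {N : ℕ} (u : ((Fin N → ℝ) × ℝ) → ℝ) (z : (Fin N → ℝ) × ℝ) : ℝ :=
  Real.sqrt ((∑ i, pX u i z ^ 2) + pY u z ^ 2)

open Set ENNReal

lemma lint_smul {E : Type*} [NormedAddCommGroup E] [NormedSpace ℝ E] [MeasurableSpace E]
    [BorelSpace E] [FiniteDimensional ℝ E] (μ : Measure E) [μ.IsAddHaarMeasure]
    (f : E → ℝ≥0∞) (r : ℝ) (hr : r ≠ 0) :
    ∫⁻ x, f (r • x) ∂μ = ENNReal.ofReal |(r ^ Module.finrank ℝ E)⁻¹| * ∫⁻ x, f x ∂μ := by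
  have h := lintegral_map_equiv (μ := μ) f (Homeomorph.smulOfNeZero r hr).toMeasurableEquiv
  have h2 : μ.map (Homeomorph.smulOfNeZero r hr).toMeasurableEquiv
      = ENNReal.ofReal |(r ^ Module.finrank ℝ E)⁻¹| • μ := Measure.map_addHaar_smul μ hr
  rw [h2, lintegral_smul_measure] at h
  exact h.symm

lemma jensen_aux {X : Type*} [MeasurableSpace X] (μ : Measure X) (f : X → ℝ≥0∞)
    (hf : Measurable f) (q : ℝ) (hq : 1 ≤ q) :
    (∫⁻ x, f x ∂μ) ^ q ≤ (∫⁻ x, f x ^ q ∂μ) * μ univ ^ (q - 1) := by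
  have h := eLpNorm'_le_eLpNorm'_mul_rpow_measure_univ (μ := μ) (f := f) (p := 1) (q := q)
    one_pos hq hf.aestronglyMeasurable
  simp only [eLpNorm', enorm_eq_self, ENNReal.rpow_one, div_one] at h
  have hq0 : 0 < q := by linarith
  calc (∫⁻ x, f x ∂μ) ^ q ≤ ((∫⁻ x, f x ^ q ∂μ) ^ (1 / q) * μ univ ^ (1 - 1 / q)) ^ q := by
        gcongr
    _ = _ := by
        rw [ENNReal.mul_rpow_of_nonneg _ _ hq0.le, ← ENNReal.rpow_mul, ← ENNReal.rpow_mul]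
        congr 1
        · rw [one_div_mul_cancel hq0.ne', ENNReal.rpow_one]
        · congr 1; field_simp

lemma beta_aux (a b : ℝ) (ha : -1 < a) (hb : -1 < b) :
    ∃ C : ℝ≥0∞, C ≠ ⊤ ∧ ∀ Y : ℝ, 0 < Y →
      ∫⁻ y in Ioo 0 Y, ENNReal.ofReal (y ^ a * (Y - y) ^ b)
        = C * ENNReal.ofReal (Y ^ (a + b + 1)) := by
  refine ⟨∫⁻ y in Ioo 0 1, ENNReal.ofReal (y ^ a * (1 - y) ^ b), ?_, ?_⟩
  · have h := Complex.betaIntegral_convergent (u := (a + 1 : ℝ)) (v := (b + 1 : ℝ))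
      (by simp; linarith) (by simp; linarith)
    rw [intervalIntegrable_iff_integrableOn_Ioo_of_le zero_le_one] at h
    have h2 := h.2
    rw [hasFiniteIntegral_iff_enorm] at h2
    refine ne_of_lt (lt_of_le_of_lt (le_of_eq ?_) h2)
    refine setLIntegral_congr_fun measurableSet_Ioo ?_
    intro y hy
    dsimp only
    rw [← ofReal_norm]
    congr 1
    have e1 : (1 - (y : ℂ)) = ((1 - y : ℝ) : ℂ) := by push_cast; rfl
    rw [norm_mul, e1, Complex.norm_cpow_eq_rpow_re_of_pos hy.1,
      Complex.norm_cpow_eq_rpow_re_of_pos (by linarith [hy.2])]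
    simp
  · intro Y hY
    have h := lint_smul (volume : Measure ℝ) (fun y => (Ioo 0 Y).indicator
      (fun y => ENNReal.ofReal (y ^ a * (Y - y) ^ b)) y) Y hY.ne'
    rw [lintegral_indicator measurableSet_Ioo] at h
    have h2 : ∫⁻ x : ℝ, (Ioo 0 Y).indicator
      (fun y => ENNReal.ofReal (y ^ a * (Y - y) ^ b)) (Y • x) =
        ENNReal.ofReal (Y ^ (a + b)) * ∫⁻ y in Ioo 0 1, ENNReal.ofReal (y ^ a * (1 - y) ^ b) := by
      rw [← lintegral_const_mul' _ _ ofReal_ne_top, ← lintegral_indicator measurableSet_Ioo]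
      congr 1
      ext x
      by_cases hx : x ∈ Ioo (0:ℝ) 1
      · rw [indicator_of_mem hx, indicator_of_mem, ← ENNReal.ofReal_mul (by positivity)]
        · congr 1
          rw [smul_eq_mul, Real.mul_rpow hY.le hx.1.le, show Y - Y * x = Y * (1 - x) by ring,
            Real.mul_rpow hY.le (by linarith [hx.2]), Real.rpow_add hY]
          ring
        · constructor
          · exact mul_pos hY hx.1
          · have := mul_lt_mul_of_pos_left hx.2 hY
            simpa using this
      · rw [indicator_of_notMem hx, indicator_of_notMem]
        intro h
        apply hx
        simp only [smul_eq_mul, mem_Ioo] at h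
        constructor
        · exact pos_of_mul_pos_right h.1 hY.le
        · nlinarith [h.2]
    rw [h2] at h
    have h3 : ENNReal.ofReal Y * ENNReal.ofReal |(Y ^ Module.finrank ℝ ℝ)⁻¹| = 1 := by
      rw [← ENNReal.ofReal_mul hY.le]
      simp [abs_of_pos hY, hY.ne']
    calc _ = (ENNReal.ofReal Y * ENNReal.ofReal |(Y ^ Module.finrank ℝ ℝ)⁻¹|) *
            ∫⁻ y in Ioo 0 Y, ENNReal.ofReal (y ^ a * (Y - y) ^ b) := by rw [h3, one_mul]
      _ = _ := by
        rw [mul_assoc, ← h, Real.rpow_add hY (a+b) 1, ENNReal.ofReal_mul (by positivity),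
          Real.rpow_one]
        ring

/-- cone kernel -/
def KK {N : ℕ} (w : (Fin N → ℝ) × ℝ) : ℝ≥0∞ :=
  Set.indicator {w : (Fin N → ℝ) × ℝ | 0 < w.2 ∧ w.2⁻¹ • w.1 ∈ Icc (0 : Fin N → ℝ) 1}
    (fun w => ENNReal.ofReal ((w.2 ^ N)⁻¹)) w

lemma measSet_KK {N : ℕ} : MeasurableSet
    {w : (Fin N → ℝ) × ℝ | 0 < w.2 ∧ w.2⁻¹ • w.1 ∈ Icc (0 : Fin N → ℝ) 1} := by
  apply MeasurableSet.inter
  · exact measurableSet_lt measurable_const measurable_snd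
  · have : Measurable (fun w : (Fin N → ℝ) × ℝ => w.2⁻¹ • w.1) :=
      (measurable_snd.inv).smul measurable_fst
    exact this measurableSet_Icc

lemma meas_KK {N : ℕ} : Measurable (KK (N := N)) := by
  unfold KK
  apply Measurable.indicator _ measSet_KK
  fun_prop

lemma grad_cont {N : ℕ} {u : ((Fin N → ℝ) × ℝ) → ℝ} (hu : ContDiff ℝ 1 u) :
    Continuous (gradNorm u) := by
  have h := hu.continuous_fderiv (by norm_num)
  unfold gradNorm pX pY
  have := fun v : (Fin N → ℝ) × ℝ => h.clm_apply (continuous_const (y := v))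
  fun_prop

lemma grad_nonneg {N : ℕ} {u : ((Fin N → ℝ) × ℝ) → ℝ} (z) : 0 ≤ gradNorm u z :=
  Real.sqrt_nonneg _

lemma pX_le {N : ℕ} {u : ((Fin N → ℝ) × ℝ) → ℝ} (z) (i : Fin N) : |pX u i z| ≤ gradNorm u z := by
  unfold gradNorm
  apply Real.abs_le_sqrt
  have := Finset.single_le_sum (f := fun i => pX u i z ^ 2) (fun i _ => sq_nonneg _)
    (Finset.mem_univ i)
  nlinarith [sq_nonneg (pY u z)]

lemma pY_le {N : ℕ} {u : ((Fin N → ℝ) × ℝ) → ℝ} (z) : |pY u z| ≤ gradNorm u z := by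
  unfold gradNorm
  apply Real.abs_le_sqrt
  have := Finset.sum_nonneg (s := Finset.univ) (f := fun i => pX u i z ^ 2) (fun i _ => sq_nonneg _)
  linarith

lemma fderiv_le {N : ℕ} {u : ((Fin N → ℝ) × ℝ) → ℝ} (z w : (Fin N → ℝ) × ℝ)  :
    |fderiv ℝ u z w| ≤ (N + 1) * gradNorm u z * ‖w‖ := by
  have e : w = ∑ i, w.1 i • ((Pi.single i 1, 0) : (Fin N → ℝ) × ℝ) + w.2 • (0, 1) := by
    ext i
    · simp [Prod.fst_sum, Finset.sum_apply, Pi.single_apply]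
    · simp [Prod.snd_sum]
  have e2 : fderiv ℝ u z w = ∑ i, w.1 i * pX u i z + w.2 * pY u z := by
    conv_lhs => rw [e]
    rw [map_add, map_sum]
    simp only [map_smul, smul_eq_mul, pX, pY]
  rw [e2]
  have h1 : ∀ i, |w.1 i * pX u i z| ≤ gradNorm u z * ‖w‖ := by
    intro i
    rw [abs_mul, mul_comm]
    have : |w.1 i| ≤ ‖w‖ := (norm_le_pi_norm w.1 i).trans (norm_fst_le w)
    exact mul_le_mul (pX_le z i) this (abs_nonneg _) (grad_nonneg z)
  have h2 : |w.2 * pY u z| ≤ gradNorm u z * ‖w‖ := by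
    rw [abs_mul, mul_comm]
    have : |w.2| ≤ ‖w‖ := norm_snd_le w
    exact mul_le_mul (pY_le z) this (abs_nonneg _) (grad_nonneg z)
  calc _ ≤ |∑ i, w.1 i * pX u i z| + |w.2 * pY u z| := abs_add_le _ _
    _ ≤ ∑ i, |w.1 i * pX u i z| + gradNorm u z * ‖w‖ :=
        add_le_add (Finset.abs_sum_le_sum_abs _ _) h2
    _ ≤ ∑ i : Fin N, gradNorm u z * ‖w‖ + gradNorm u z * ‖w‖ := by
        gcongr with i; exact h1 i
    _ = _ := by simp; ring

lemma rep_line {N : ℕ} {u : ((Fin N → ℝ) × ℝ) → ℝ} (hu : ContDiff ℝ 1 u)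
    (hc : HasCompactSupport u) (z : (Fin N → ℝ) × ℝ) (a : Fin N → ℝ) (ha : a ∈ Icc (0 : Fin N → ℝ) 1) :
    ‖u z‖ₑ ≤ ∫⁻ t in Ioi (0:ℝ), ENNReal.ofReal ((N + 1) * gradNorm u (z + (t • a, t))) := by
  set v : (Fin N → ℝ) × ℝ := (a, 1) with hv
  have hvn : ‖v‖ ≤ 1 := by
    rw [Prod.norm_def]
    apply max_le
    · rw [pi_norm_le_iff_of_nonneg zero_le_one]
      intro i
      rw [Real.norm_eq_abs, abs_le]
      have h1 := ha.1 i
      have h2 := ha.2 i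
      simp only [Pi.zero_apply, Pi.one_apply] at h1 h2
      constructor <;> linarith
    · simp [hv]
  have hline : ∀ t : ℝ, HasDerivAt (fun t : ℝ => z - t • v) (-v) t := by
    intro t
    have := ((hasDerivAt_id t).smul_const v).const_sub z
    simpa using this
  have hf : ContDiff ℝ 1 (fun t : ℝ => u (z - t • v)) := by fun_prop
  have hfc : HasCompactSupport (fun t : ℝ => u (z - t • v)) := by
    obtain ⟨R, hR⟩ := hc.isCompact.isBounded.subset_closedBall 0
    apply HasCompactSupport.intro (isCompact_Icc (a := z.2 - R) (b := z.2 + R))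
    intro t ht
    by_contra h
    apply ht
    have h1 := hR (subset_tsupport _ h)
    rw [mem_closedBall_zero_iff] at h1
    have h2 := (norm_snd_le _).trans h1
    simp only [hv, Prod.snd_sub, Prod.smul_snd, smul_eq_mul, mul_one, Real.norm_eq_abs, abs_le] at h2
    constructor <;> linarith
  have hder : ∀ t, ‖deriv (fun t : ℝ => u (z - t • v)) t‖ₑ ≤
      ENNReal.ofReal ((N + 1) * gradNorm u (z - t • v)) := by
    intro t
    have h1 := ((hu.differentiable (by norm_num)) (z - t • v)).hasFDerivAt.comp_hasDerivAt t (hline t)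
    have h1' : deriv (fun t : ℝ => u (z - t • v)) t = fderiv ℝ u (z - t • v) (-v) := h1.deriv
    rw [h1', ← ofReal_norm]
    apply ENNReal.ofReal_le_ofReal
    refine (fderiv_le _ _).trans ?_
    rw [norm_neg]
    have := grad_nonneg (u := u) (z - t • v)
    exact mul_le_of_le_one_right (by positivity) hvn
  have h := HasCompactSupport.enorm_le_lintegral_Ici_deriv hf hfc 0
  simp only [zero_smul, sub_zero] at h
  refine h.trans ((lintegral_mono hder).trans (le_of_eq ?_))
  rw [← lintegral_indicator measurableSet_Iic, ← lintegral_neg_eq_self,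
    setLIntegral_congr Ioi_ae_eq_Ici, ← lintegral_indicator measurableSet_Ici]
  congr 1
  ext t
  have e : z - (-t) • v = z + (t • a, t) := by
    rw [neg_smul, sub_neg_eq_add, hv]
    simp
  simp only [indicator, mem_Iic, mem_Ici, Left.neg_nonpos_iff, e]

lemma rep {N : ℕ} {u : ((Fin N → ℝ) × ℝ) → ℝ} (hu : ContDiff ℝ 1 u)
    (hc : HasCompactSupport u) (z : (Fin N → ℝ) × ℝ) :
    ‖u z‖ₑ ≤ ∫⁻ w, KK w * ENNReal.ofReal ((N + 1) * gradNorm u (z + w)) := by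
  have hg := grad_cont hu
  have hA : volume (Icc (0 : Fin N → ℝ) 1) = 1 := by simp [Real.volume_Icc_pi]
  calc ‖u z‖ₑ = ∫⁻ a in Icc (0 : Fin N → ℝ) 1, ‖u z‖ₑ := by simp [hA]
    _ ≤ ∫⁻ a in Icc (0 : Fin N → ℝ) 1, ∫⁻ t in Ioi (0:ℝ),
        ENNReal.ofReal ((N + 1) * gradNorm u (z + (t • a, t))) :=
      setLIntegral_mono' measurableSet_Icc fun a ha => rep_line hu hc z a ha
    _ = ∫⁻ t in Ioi (0:ℝ), ∫⁻ a in Icc (0 : Fin N → ℝ) 1,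
        ENNReal.ofReal ((N + 1) * gradNorm u (z + (t • a, t))) := by
      apply lintegral_lintegral_swap
      apply Measurable.aemeasurable
      apply ENNReal.measurable_ofReal.comp
      apply Continuous.measurable
      fun_prop
    _ = ∫⁻ t in Ioi (0:ℝ), ∫⁻ ξ, KK (ξ, t) * ENNReal.ofReal ((N + 1) * gradNorm u (z + (ξ, t))) := by
      apply setLIntegral_congr_fun measurableSet_Ioi
      intro t ht
      have ht : 0 < t := ht
      dsimp only
      have h := lint_smul (volume : Measure (Fin N → ℝ)) (fun ξ =>
        {ξ : Fin N → ℝ | t⁻¹ • ξ ∈ Icc (0 : Fin N → ℝ) 1}.indicator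
          (fun ξ => ENNReal.ofReal ((N + 1) * gradNorm u (z + (ξ, t)))) ξ) t ht.ne'
      rw [← lintegral_indicator measurableSet_Icc]
      have h2 : ∀ a : Fin N → ℝ, (Icc (0 : Fin N → ℝ) 1).indicator
          (fun a => ENNReal.ofReal ((N + 1) * gradNorm u (z + (t • a, t)))) a =
          {ξ : Fin N → ℝ | t⁻¹ • ξ ∈ Icc (0 : Fin N → ℝ) 1}.indicator
          (fun ξ => ENNReal.ofReal ((N + 1) * gradNorm u (z + (ξ, t)))) (t • a) := by
        intro a
        have hi : t⁻¹ • t • a = a := inv_smul_smul₀ ht.ne' a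
        by_cases hx : a ∈ Icc (0 : Fin N → ℝ) 1
        · rw [indicator_of_mem hx, indicator_of_mem]
          rw [mem_ofPred_eq, hi]; exact hx
        · rw [indicator_of_notMem hx, indicator_of_notMem]
          rw [mem_ofPred_eq, hi]; exact hx
      simp_rw [h2]
      rw [h, ← lintegral_const_mul' _ _ ofReal_ne_top]
      congr 1
      ext ξ
      unfold KK
      by_cases hx : t⁻¹ • ξ ∈ Icc (0 : Fin N → ℝ) 1
      · rw [indicator_of_mem (by exact hx), indicator_of_mem (by exact ⟨ht, hx⟩)]
        simp [abs_of_pos ht]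
      · rw [indicator_of_notMem (by exact hx), indicator_of_notMem (by exact fun h => hx h.2)]
        simp
    _ = ∫⁻ t : ℝ, ∫⁻ ξ, KK (ξ, t) * ENNReal.ofReal ((N + 1) * gradNorm u (z + (ξ, t))) := by
      rw [← lintegral_indicator measurableSet_Ioi]
      congr 1
      ext t
      by_cases ht : t ∈ Ioi (0:ℝ)
      · rw [indicator_of_mem ht]
      · rw [indicator_of_notMem ht]
        have : ∀ ξ : Fin N → ℝ, KK (ξ, t) = 0 := by
          intro ξ
          apply indicator_of_notMem
          intro h; exact ht h.1
        simp [this]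
    _ = _ := by
      rw [Measure.volume_eq_prod, lintegral_prod_symm]
      apply Measurable.aemeasurable
      apply meas_KK.mul
      apply ENNReal.measurable_ofReal.comp
      apply Continuous.measurable
      fun_prop

lemma haar_inst {N : ℕ} : (volume : Measure ((Fin N → ℝ) × ℝ)).IsAddHaarMeasure := by
  rw [Measure.volume_eq_prod]; infer_instance

lemma measSet_HS {N : ℕ} : MeasurableSet (HS N) :=
  measurableSet_lt measurable_const measurable_snd

/-- weighted energy -/
def MM {N : ℕ} (α : ℝ) (u : ((Fin N → ℝ) × ℝ) → ℝ) : ℝ≥0∞ :=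
  ∫⁻ z in HS N, ENNReal.ofReal (z.2 ^ α * gradNorm u z)

/-- weighted power integral -/
def TT {N : ℕ} (p q : ℝ) (u : ((Fin N → ℝ) × ℝ) → ℝ) : ℝ≥0∞ :=
  ∫⁻ z in HS N, ENNReal.ofReal (z.2 ^ p * |u z| ^ q)

lemma kernel_int (N : ℕ) (p q : ℝ) (hq : 1 ≤ q) (hqN : q * N < N + 1) (hp : -1 < p) :
    ∃ C : ℝ≥0∞, C ≠ ⊤ ∧ ∀ z' ∈ HS N,
      ∫⁻ z in HS N, ENNReal.ofReal (z.2 ^ p) * KK (z' - z) ^ q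
        ≤ C * ENNReal.ofReal (z'.2 ^ (p + (N - N * q) + 1)) := by
  obtain ⟨C, hC, h⟩ := beta_aux p (N - N * q) hp (by linarith)
  refine ⟨C, hC, ?_⟩
  intro z' hz'
  rw [← h z'.2 hz', ← lintegral_indicator measSet_HS, Measure.volume_eq_prod,
    lintegral_prod_symm, ← lintegral_indicator measurableSet_Ioo]
  · apply lintegral_mono
    intro y
    dsimp only
    by_cases hy : y ∈ Ioo 0 z'.2
    · rw [indicator_of_mem hy]
      have hy1 := hy.1
      have ht : 0 < z'.2 - y := by linarith [hy.2]
      have hi : ∀ x : Fin N → ℝ, (HS N).indicator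
          (fun z => ENNReal.ofReal (z.2 ^ p) * KK (z' - z) ^ q) (x, y) =
          (Icc (z'.1 - fun _ => (z'.2 - y)) z'.1).indicator
            (fun _ => ENNReal.ofReal (y ^ p * (z'.2 - y) ^ (-(N * q)))) x := by
        intro x
        rw [indicator_of_mem (by exact hy1)]
        have hm : (0 < (z' - (x, y)).2 ∧ (z' - (x, y)).2⁻¹ • (z' - (x, y)).1 ∈ Icc (0 : Fin N → ℝ) 1)
            ↔ x ∈ Icc (z'.1 - fun _ => (z'.2 - y)) z'.1 := by
          simp only [Prod.snd_sub, Prod.fst_sub, mem_Icc, Pi.le_def, ht, true_and]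
          simp only [Pi.zero_apply, Pi.smul_apply, Pi.sub_apply, Pi.one_apply, smul_eq_mul]
          rw [and_comm]
          apply and_congr
          · apply forall_congr'
            intro i
            rw [inv_mul_le_iff₀ ht]
            constructor <;> intro h <;> linarith
          · apply forall_congr'
            intro i
            rw [mul_nonneg_iff_of_pos_left (inv_pos.2 ht)]
            constructor <;> intro h <;> linarith
        unfold KK
        by_cases hx : x ∈ Icc (z'.1 - fun _ => (z'.2 - y)) z'.1
        · rw [indicator_of_mem hx, indicator_of_mem (by exact hm.2 hx)]
          rw [ENNReal.ofReal_rpow_of_nonneg (by simp; positivity) (by linarith),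
            ← ENNReal.ofReal_mul (by positivity)]
          congr 2
          simp only [Prod.snd_sub]
          rw [← Real.rpow_natCast, ← Real.rpow_neg ht.le, ← Real.rpow_mul ht.le]
          congr 1; ring
        · rw [indicator_of_notMem hx, indicator_of_notMem (by exact fun h => hx (hm.1 h))]
          rw [ENNReal.zero_rpow_of_pos (by linarith), mul_zero]
      simp_rw [hi]
      rw [lintegral_indicator measurableSet_Icc, setLIntegral_const, Real.volume_Icc_pi]
      simp only [Pi.sub_apply, _root_.sub_sub_cancel, Finset.prod_const, Finset.card_univ, Fintype.card_fin]
      rw [← ENNReal.ofReal_pow ht.le, ← ENNReal.ofReal_mul (by positivity)]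
      apply le_of_eq
      congr 1
      rw [mul_assoc, ← Real.rpow_natCast, ← Real.rpow_add ht]
      congr 2; ring
    · rw [indicator_of_notMem hy]
      have hi : ∀ x : Fin N → ℝ, (HS N).indicator
          (fun z => ENNReal.ofReal (z.2 ^ p) * KK (z' - z) ^ q) (x, y) = 0 := by
        intro x
        by_cases hy1 : 0 < y
        · rw [indicator_of_mem (by exact hy1)]
          have : KK (z' - (x, y)) = 0 := by
            apply indicator_of_notMem
            intro h
            have := h.1
            simp only [Prod.snd_sub] at this
            exact hy ⟨hy1, by linarith⟩
          rw [this, ENNReal.zero_rpow_of_pos (by linarith), mul_zero]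
        · exact indicator_of_notMem (by exact hy1) _
      simp_rw [hi]
      simp
  · apply Measurable.aemeasurable
    apply Measurable.indicator _ measSet_HS
    apply Measurable.mul
    · fun_prop
    · exact (meas_KK.comp (measurable_const.sub measurable_id)).pow_const q

lemma subcrit (N : ℕ) (α p q : ℝ) (hq : 1 ≤ q) (hqN : q * N < N + 1) (hp : -1 < p)
    (hpe : p = α * q + N * q - N - 1) :
    ∃ C : ℝ≥0∞, C ≠ ⊤ ∧ ∀ u : ((Fin N → ℝ) × ℝ) → ℝ, ContDiff ℝ 1 u → HasCompactSupport u →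
      TT p q u ≤ C * MM α u ^ q := by
  obtain ⟨C, hC, hker⟩ := kernel_int N p q hq hqN hp
  have hq0 : 0 < q := by linarith
  refine ⟨ENNReal.ofReal (N + 1) ^ q * C, ENNReal.mul_ne_top
    (ENNReal.rpow_ne_top_of_nonneg hq0.le ofReal_ne_top) hC, ?_⟩
  intro u hu hc
  have hg := grad_cont hu
  set c : ℝ≥0∞ := ENNReal.ofReal (N + 1) with hcdef
  set ρ : (Fin N → ℝ) × ℝ → ℝ≥0∞ := fun z => ENNReal.ofReal (z.2 ^ α * gradNorm u z) with hρ
  have hρm : Measurable ρ := by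
    apply ENNReal.measurable_ofReal.comp
    exact (measurable_snd.pow_const α).mul hg.measurable
  set μ := ((volume : Measure ((Fin N → ℝ) × ℝ)).restrict (HS N)).withDensity ρ with hμ
  have hμu : μ univ = MM α u := by
    rw [hμ, withDensity_apply _ MeasurableSet.univ, Measure.restrict_univ]; rfl
  have hpt : ∀ z ∈ HS N, ‖u z‖ₑ ^ q ≤ c ^ q * (∫⁻ z' in HS N, ENNReal.ofReal (z'.2 ^ (-α * q)) *
      KK (z' - z) ^ q * ρ z') * MM α u ^ (q - 1) := by
    intro z hz
    have h1 : ‖u z‖ₑ ≤ c * ∫⁻ z', ENNReal.ofReal (z'.2 ^ (-α)) * KK (z' - z) ∂μ := by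
      refine (rep hu hc z).trans (le_of_eq ?_)
      have := haar_inst (N := N)
      rw [← lintegral_sub_right_eq_self _ z]
      rw [hμ, lintegral_withDensity_eq_lintegral_mul _ hρm, ← lintegral_indicator measSet_HS,
        ← lintegral_const_mul' _ _ ofReal_ne_top]
      · congr 1
        ext z'
        by_cases hz' : z' ∈ HS N
        · have hz2 : 0 < z'.2 := hz'
          rw [indicator_of_mem hz', add_sub_cancel, ENNReal.ofReal_mul (by positivity),
            Pi.mul_apply, hρ]
          dsimp only
          rw [ENNReal.ofReal_mul (by positivity)]
          have : ENNReal.ofReal (z'.2 ^ α) * ENNReal.ofReal (z'.2 ^ (-α)) = 1 := by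
            rw [← ENNReal.ofReal_mul (by positivity), ← Real.rpow_add hz2]; simp
          calc _ = c * ((ENNReal.ofReal (z'.2 ^ α) * ENNReal.ofReal (z'.2 ^ (-α))) *
                (ENNReal.ofReal (gradNorm u z') * KK (z' - z))) := by rw [this]; ring
            _ = _ := by ring
        · rw [indicator_of_notMem hz', mul_zero]
          have : KK (z' - z) = 0 := by
            apply indicator_of_notMem
            intro h
            have h1 := h.1
            simp only [Prod.snd_sub] at h1
            have hz2 : 0 < z.2 := hz
            exact hz' (by show 0 < z'.2; linarith)
          rw [this, zero_mul]
      · apply Measurable.mul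
        · fun_prop
        · exact meas_KK.comp (measurable_id.sub measurable_const)
    calc ‖u z‖ₑ ^ q ≤ (c * ∫⁻ z', ENNReal.ofReal (z'.2 ^ (-α)) * KK (z' - z) ∂μ) ^ q := by gcongr
      _ = c ^ q * (∫⁻ z', ENNReal.ofReal (z'.2 ^ (-α)) * KK (z' - z) ∂μ) ^ q :=
          ENNReal.mul_rpow_of_nonneg _ _ hq0.le
      _ ≤ c ^ q * ((∫⁻ z', (ENNReal.ofReal (z'.2 ^ (-α)) * KK (z' - z)) ^ q ∂μ) * μ univ ^ (q - 1)) := by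
          gcongr
          apply jensen_aux _ _ _ _ hq
          apply Measurable.mul
          · fun_prop
          · exact meas_KK.comp (measurable_id.sub measurable_const)
      _ = _ := by
          rw [hμu, mul_assoc]
          congr 2
          rw [hμ, lintegral_withDensity_eq_lintegral_mul _ hρm]
          · apply setLIntegral_congr_fun measSet_HS
            intro z' hz'
            have hz2 : 0 < z'.2 := hz'
            simp only [Pi.mul_apply]
            rw [ENNReal.mul_rpow_of_nonneg _ _ hq0.le,
              ENNReal.ofReal_rpow_of_nonneg (by positivity) hq0.le, ← Real.rpow_mul hz2.le]
            ring
          · apply Measurable.pow_const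
            apply Measurable.mul
            · fun_prop
            · exact meas_KK.comp (measurable_id.sub measurable_const)
  have hmeas2 : Measurable (fun zz : ((Fin N → ℝ) × ℝ) × ((Fin N → ℝ) × ℝ) =>
      ENNReal.ofReal (zz.2.2 ^ (-α * q)) * KK (zz.2 - zz.1) ^ q * ρ zz.2) := by
    apply Measurable.mul
    · apply Measurable.mul
      · fun_prop
      · exact (meas_KK.comp (measurable_snd.sub measurable_fst)).pow_const q
    · exact hρm.comp measurable_snd
  calc TT p q u = ∫⁻ z in HS N, ENNReal.ofReal (z.2 ^ p) * ‖u z‖ₑ ^ q := by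
        apply setLIntegral_congr_fun measSet_HS
        intro z hz
        have hz2 : 0 < z.2 := hz
        dsimp only
        rw [ENNReal.ofReal_mul (by positivity), ← ofReal_norm,
          ENNReal.ofReal_rpow_of_nonneg (by positivity) hq0.le, Real.norm_eq_abs]
    _ ≤ ∫⁻ z in HS N, (ENNReal.ofReal (z.2 ^ p) * (∫⁻ z' in HS N, ENNReal.ofReal (z'.2 ^ (-α * q)) *
      KK (z' - z) ^ q * ρ z')) * (c ^ q * MM α u ^ (q - 1)) := by
        apply setLIntegral_mono' measSet_HS
        intro z hz
        refine (mul_le_mul_right (hpt z hz) _).trans (le_of_eq ?_)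
        ring
    _ = (∫⁻ z in HS N, (ENNReal.ofReal (z.2 ^ p) * (∫⁻ z' in HS N, ENNReal.ofReal (z'.2 ^ (-α * q)) *
      KK (z' - z) ^ q * ρ z'))) * (c ^ q * MM α u ^ (q - 1)) := by
        apply lintegral_mul_const
        apply Measurable.mul
        · fun_prop
        · exact hmeas2.lintegral_prod_right'
    _ = (∫⁻ z in HS N, ∫⁻ z' in HS N, ENNReal.ofReal (z.2 ^ p) * (ENNReal.ofReal (z'.2 ^ (-α * q)) *
      KK (z' - z) ^ q * ρ z')) * (c ^ q * MM α u ^ (q - 1)) := by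
        congr 2
        ext z
        rw [lintegral_const_mul' _ _ ofReal_ne_top]
    _ = (∫⁻ z' in HS N, ∫⁻ z in HS N, ENNReal.ofReal (z.2 ^ p) * (ENNReal.ofReal (z'.2 ^ (-α * q)) *
      KK (z' - z) ^ q * ρ z')) * (c ^ q * MM α u ^ (q - 1)) := by
        congr 1
        apply lintegral_lintegral_swap
        apply Measurable.aemeasurable
        apply Measurable.mul _ hmeas2
        fun_prop
    _ ≤ (∫⁻ z' in HS N, C * ρ z') * (c ^ q * MM α u ^ (q - 1)) := by
        gcongr 1
        apply setLIntegral_mono' measSet_HS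
        intro z' hz'
        have hz2 : 0 < z'.2 := hz'
        calc _ = (ENNReal.ofReal (z'.2 ^ (-α * q)) * ρ z') *
              ∫⁻ z in HS N, ENNReal.ofReal (z.2 ^ p) * KK (z' - z) ^ q := by
              rw [← lintegral_const_mul' _ _ (ENNReal.mul_ne_top ofReal_ne_top ofReal_ne_top)]
              congr 1
              ext z
              ring
          _ ≤ (ENNReal.ofReal (z'.2 ^ (-α * q)) * ρ z') *
              (C * ENNReal.ofReal (z'.2 ^ (p + (N - N * q) + 1))) := by
              gcongr; exact hker z' hz'
          _ = C * ρ z' * (ENNReal.ofReal (z'.2 ^ (-α * q)) *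
                 ENNReal.ofReal (z'.2 ^ (p + (N - N * q) + 1))) := by ring
          _ = C * ρ z' := by
              rw [← ENNReal.ofReal_mul (by positivity), ← Real.rpow_add hz2,
                show -α * q + (p + (N - N * q) + 1) = 0 by rw [hpe]; ring]
              simp
    _ = C * MM α u * (c ^ q * MM α u ^ (q - 1)) := by
        rw [lintegral_const_mul' _ _ hC]; rfl
    _ = c ^ q * C * (MM α u ^ (q - 1) * MM α u ^ (1:ℝ)) := by rw [ENNReal.rpow_one]; ring
    _ = _ := by
        rw [← ENNReal.rpow_add_of_nonneg _ _ (by linarith) zero_le_one, sub_add_cancel]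

lemma cutoff (r : ℝ) (hr : 1 ≤ r) : ∃ F : ℝ → ℝ, ∃ B : ℝ, 0 < B ∧ ContDiff ℝ 1 F ∧
    (∀ s, |s| ≤ 1 / 2 → F s = 0) ∧ (∀ s, 1 ≤ |s| → F s = s) ∧
    (∀ s, |F s| ≤ B * |s| ^ r) ∧ (∀ s, |deriv F s| ≤ B) ∧ (∀ s, |s| * |deriv F s| ≤ B * |s| ^ r) := by
  set F : ℝ → ℝ := fun s => s * Real.smoothTransition (2 * s ^ 2 - 1) with hF
  have hFc : ContDiff ℝ 1 F := by
    apply contDiff_id.mul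
    exact (Real.smoothTransition.contDiff (n := 1)).comp (by fun_prop)
  have h0 : ∀ s, |s| ≤ 1 / 2 → F s = 0 := by
    intro s hs
    have h1 : s ^ 2 ≤ (1/2) ^ 2 := sq_le_sq' (by linarith [(abs_le.1 hs).1]) (abs_le.1 hs).2
    simp only [hF]
    rw [Real.smoothTransition.zero_of_nonpos (by linarith), mul_zero]
  have h1 : ∀ s, 1 ≤ |s| → F s = s := by
    intro s hs
    have h1 : 1 ≤ s ^ 2 := by rw [← sq_abs]; nlinarith
    simp only [hF]
    rw [Real.smoothTransition.one_of_one_le (by linarith), mul_one]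
  have hd := hFc.continuous_deriv le_rfl
  obtain ⟨B0, hB0⟩ := (isCompact_Icc (a := (-1:ℝ)) (b := 1)).exists_bound_of_continuousOn hd.continuousOn
  have hdb : ∀ s, |deriv F s| ≤ max B0 1 := by
    intro s
    by_cases hs : |s| ≤ 1
    · exact (hB0 s (abs_le.1 hs)).trans (le_max_left _ _)
    · have : F =ᶠ[nhds s] id := by
        have ho : IsOpen {s : ℝ | 1 < |s|} := isOpen_lt continuous_const continuous_abs
        filter_upwards [ho.mem_nhds (not_le.1 hs)] with t ht
        exact h1 t (le_of_lt ht)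
      rw [this.deriv_eq]
      simp
  have hd0 : ∀ s, |s| < 1 / 2 → deriv F s = 0 := by
    intro s hs
    have : F =ᶠ[nhds s] fun _ => 0 := by
      have ho : IsOpen {s : ℝ | |s| < 1 / 2} := isOpen_lt continuous_abs continuous_const
      filter_upwards [ho.mem_nhds hs] with t ht
      exact h0 t (le_of_lt ht)
    rw [this.deriv_eq]
    simp
  have hs : ∀ s : ℝ, 1 / 2 ≤ |s| → |s| ≤ 2 ^ (r - 1) * |s| ^ r := by
    intro s hs
    have hp : 0 < |s| := by linarith
    have e : |s| ^ r = |s| ^ (r - 1) * |s| := by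
      conv_rhs => rw [← Real.rpow_one |s|, ← Real.rpow_mul hp.le, ← Real.rpow_add hp]
      congr 1; ring
    rw [e, ← mul_assoc, ← Real.mul_rpow (by norm_num) hp.le]
    have := Real.one_le_rpow (x := 2 * |s|) (z := r - 1) (by linarith) (by linarith)
    nlinarith
  have hM1 : 1 ≤ max B0 1 := le_max_right _ _
  have h2p : (0:ℝ) < 2 ^ (r - 1) := by positivity
  refine ⟨F, max B0 1 * 2 ^ (r - 1) + max B0 1, by positivity, hFc, h0, h1, ?_, ?_, ?_⟩
  · intro s
    by_cases h : |s| ≤ 1 / 2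
    · rw [h0 s h, abs_zero]; positivity
    · have hF1 : |F s| ≤ |s| := by
        simp only [hF]
        rw [abs_mul, abs_of_nonneg (Real.smoothTransition.nonneg _)]
        exact mul_le_of_le_one_right (abs_nonneg _) (Real.smoothTransition.le_one _)
      have h3 := hs s (by linarith)
      have h4 : 0 ≤ |s| ^ r := by positivity
      calc |F s| ≤ 1 * (2 ^ (r - 1) * |s| ^ r) + 0 := by linarith
        _ ≤ max B0 1 * (2 ^ (r - 1) * |s| ^ r) + max B0 1 * |s| ^ r := by gcongr; positivity
        _ = _ := by ring
  · intro s
    have := hdb s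
    have : 0 ≤ max B0 1 * 2 ^ (r - 1) := by positivity
    linarith [hdb s]
  · intro s
    by_cases h : |s| < 1 / 2
    · rw [hd0 s h, abs_zero, mul_zero]; positivity
    · have h3 := hs s (by linarith)
      have h4 : 0 ≤ |s| ^ r := by positivity
      calc |s| * |deriv F s| ≤ (2 ^ (r - 1) * |s| ^ r) * max B0 1 + 0 := by
            rw [add_zero]; gcongr; exact hdb s
        _ ≤ (2 ^ (r - 1) * |s| ^ r) * max B0 1 + max B0 1 * |s| ^ r := by gcongr; positivity
        _ = _ := by ring

lemma norm_fderiv_le {N : ℕ} {u : ((Fin N → ℝ) × ℝ) → ℝ} (z : (Fin N → ℝ) × ℝ) :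
    ‖fderiv ℝ u z‖ ≤ (N + 1) * gradNorm u z := by
  apply ContinuousLinearMap.opNorm_le_bound
  · have := grad_nonneg (u := u) z
    positivity
  · intro w
    exact fderiv_le z w

lemma crit_step (N : ℕ) (hN : 1 ≤ N) (α q r p : ℝ) (hq : q = ((N:ℝ) + 1) / N) (hr : 1 ≤ r) (hrq : r ≤ q)
    (hα : 0 < α + N) (hp : p = α * r + N * r - N - 1) :
    ∃ C : ℝ≥0∞, C ≠ ⊤ ∧ ∀ u : ((Fin N → ℝ) × ℝ) → ℝ, ContDiff ℝ 1 u → HasCompactSupport u →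
      TT (α * q) q u ≤ TT p r u + C * (MM α u + TT p r u) ^ q := by
  have hN0 : (0:ℝ) < N := by exact_mod_cast hN
  have hq0 : 0 < q := by rw [hq]; positivity
  obtain ⟨F, B, hB, hFc, hF0, hF1, hFb, hdb, hsd⟩ := cutoff r hr
  have hinst := haar_inst (N := N)
  have hfin : Module.finrank ℝ ((Fin N → ℝ) × ℝ) = N + 1 := by simp
  have hconj : Real.HolderConjugate (Module.finrank ℝ ((Fin N → ℝ) × ℝ)) q := by
    rw [hfin, hq]
    rw [Real.holderConjugate_iff]
    push_cast
    constructor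
    · linarith
    · field_simp
      ring
  set K : ℝ := B * (N + 1) + ((α + N) * B + N * B) with hK
  have hK0 : 0 < K := by positivity
  refine ⟨lintegralPowLePowLIntegralFDerivConst (volume : Measure ((Fin N → ℝ) × ℝ)) q *
    ENNReal.ofReal K ^ q, ENNReal.mul_ne_top coe_ne_top
      (ENNReal.rpow_ne_top_of_nonneg hq0.le ofReal_ne_top), ?_⟩
  intro u hu hc
  set V : (Fin N → ℝ) × ℝ → ℝ := fun z => z.2 ^ (-(N:ℝ)) * F (u z * z.2 ^ (α + N)) with hV
  set W : (Fin N → ℝ) × ℝ → ℝ := (HS N).indicator V with hW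
  have hopen : IsOpen (HS N) := isOpen_lt continuous_const continuous_snd
  have hWV : ∀ z ∈ HS N, W =ᶠ[nhds z] V := by
    intro z hz
    filter_upwards [hopen.mem_nhds hz] with w hw
    exact indicator_of_mem hw _
  obtain ⟨ε, hε, hWε⟩ : ∃ ε : ℝ, 0 < ε ∧ ∀ z : (Fin N → ℝ) × ℝ, z.2 < ε → W z = 0 := by
    obtain ⟨D, hD⟩ := hu.continuous.bounded_above_of_compact_support hc
    have hD0 : 0 ≤ D := (norm_nonneg _).trans (hD 0)
    have hcont : ContinuousAt (fun y : ℝ => D * y ^ (α + N)) 0 :=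
      continuousAt_const.mul (Real.continuousAt_rpow_const 0 _ (Or.inr hα.le))
    have hlt : ∀ᶠ y in nhds (0:ℝ), D * y ^ (α + N) < 1 / 2 := by
      apply hcont.eventually_lt continuousAt_const
      rw [Real.zero_rpow hα.ne']; norm_num
    obtain ⟨ε, hε, hb⟩ := Metric.eventually_nhds_iff.1 hlt
    refine ⟨ε, hε, ?_⟩
    intro z hz
    by_cases hz' : z ∈ HS N
    · have hz2 : 0 < z.2 := hz'
      rw [hW, indicator_of_mem hz', hV]
      dsimp only
      rw [hF0, mul_zero]
      have h1 := hb (y := z.2) (by rw [Real.dist_eq, sub_zero, abs_of_pos hz2]; exact hz)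
      rw [abs_mul, abs_of_pos (Real.rpow_pos_of_pos hz2 _)]
      have h2 : |u z| ≤ D := hD z
      have : |u z| * z.2 ^ (α + N) ≤ D * z.2 ^ (α + N) := by gcongr
      linarith
    · exact indicator_of_notMem hz' _
  have hW0 : ∀ z ∉ HS N, W =ᶠ[nhds z] fun _ => 0 := by
    intro z hz
    have ho : IsOpen {z : (Fin N → ℝ) × ℝ | z.2 < ε} := isOpen_lt continuous_snd continuous_const
    have hz2 : z.2 ≤ 0 := not_lt.1 hz
    filter_upwards [ho.mem_nhds (lt_of_le_of_lt hz2 hε)] with w hw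
    exact hWε w hw
  have hWc : ContDiff ℝ 1 W := by
    rw [contDiff_iff_contDiffAt]
    intro z
    by_cases hz : z ∈ HS N
    · have hz2 : 0 < z.2 := hz
      refine ContDiffAt.congr_of_eventuallyEq ?_ (hWV z hz)
      apply ContDiffAt.mul
      · exact contDiffAt_snd.rpow_const_of_ne hz2.ne'
      · apply hFc.contDiffAt.comp z
        apply hu.contDiffAt.mul
        exact contDiffAt_snd.rpow_const_of_ne hz2.ne'
    · exact contDiffAt_const.congr_of_eventuallyEq (hW0 z hz)
  have hWs : HasCompactSupport W := by
    apply hc.mono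
    intro z hz
    rw [Function.mem_support] at hz ⊢
    intro h
    apply hz
    by_cases hz' : z ∈ HS N
    · rw [hW, indicator_of_mem hz', hV]
      dsimp only
      rw [h, zero_mul, hF0 0 (by simp), mul_zero]
    · exact indicator_of_notMem hz' _
  have hpow : ∀ z ∈ HS N, z.2 ^ (-(N:ℝ) - 1) * |u z * z.2 ^ (α + N)| ^ r = z.2 ^ p * |u z| ^ r := by
    intro z hz
    have hz2 : 0 < z.2 := hz
    rw [abs_mul, abs_of_pos (Real.rpow_pos_of_pos hz2 _), Real.mul_rpow (abs_nonneg _) (by positivity),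
      ← Real.rpow_mul hz2.le, mul_comm (|u z| ^ r), ← mul_assoc, ← Real.rpow_add hz2]
    congr 2
    rw [hp]; ring
  have hder : ∀ z ∈ HS N, ‖fderiv ℝ W z‖ ≤ K * (z.2 ^ α * gradNorm u z + z.2 ^ p * |u z| ^ r) := by
    intro z hz
    have hz2 : 0 < z.2 := hz
    have hg := grad_nonneg (u := u) z
    rw [(hWV z hz).fderiv_eq]
    set s := u z * z.2 ^ (α + N) with hs
    have d1 : ∀ k : ℝ, HasFDerivAt (fun z : (Fin N → ℝ) × ℝ => z.2 ^ k)
        ((k * z.2 ^ (k - 1)) • ContinuousLinearMap.snd ℝ (Fin N → ℝ) ℝ) z := fun k =>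
      hasFDerivAt_snd.rpow_const (Or.inl hz2.ne')
    have d2 := ((hu.differentiable (by norm_num)) z).hasFDerivAt.mul (d1 (α + N))
    have d3 := ((hFc.differentiable (by norm_num)) s).hasDerivAt.comp_hasFDerivAt z d2
    have d4 := (d1 (-(N:ℝ))).mul d3
    have d5 : HasFDerivAt V _ z := d4
    rw [d5.fderiv]
    have hsn : ‖ContinuousLinearMap.snd ℝ (Fin N → ℝ) ℝ‖ ≤ 1 := ContinuousLinearMap.norm_snd_le _ _ _
    have hDu := norm_fderiv_le (u := u) z
    have n1 : ∀ k : ℝ, ‖(k * z.2 ^ (k - 1)) • ContinuousLinearMap.snd ℝ (Fin N → ℝ) ℝ‖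
        ≤ |k| * z.2 ^ (k - 1) := by
      intro k
      rw [norm_smul, Real.norm_eq_abs, abs_mul, abs_of_pos (Real.rpow_pos_of_pos hz2 _)]
      exact mul_le_of_le_one_right (by positivity) hsn
    refine (norm_add_le _ _).trans ?_
    have e1 : z.2 ^ (-(N:ℝ)) * z.2 ^ (α + N) = z.2 ^ α := by
      rw [← Real.rpow_add hz2]; congr 1; ring
    have e2 : z.2 ^ (-(N:ℝ)) * (|u z| * z.2 ^ (α + N - 1)) = z.2 ^ (-(N:ℝ) - 1) * |s| := by
      rw [hs, abs_mul, abs_of_pos (Real.rpow_pos_of_pos hz2 _)]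
      have : z.2 ^ (-(N:ℝ)) * z.2 ^ (α + N - 1) = z.2 ^ (-(N:ℝ) - 1) * z.2 ^ (α + N) := by
        rw [← Real.rpow_add hz2, ← Real.rpow_add hz2]; congr 1; ring
      linear_combination |u z| * this
    have t1 : ‖z.2 ^ (-(N:ℝ)) • deriv F s • (u z • ((α + N) * z.2 ^ (α + N - 1)) •
        ContinuousLinearMap.snd ℝ (Fin N → ℝ) ℝ + z.2 ^ (α + N) • fderiv ℝ u z)‖ ≤
        (B * (N + 1)) * (z.2 ^ α * gradNorm u z) + ((α + N) * B) * (z.2 ^ p * |u z| ^ r) := by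
      rw [norm_smul, norm_smul, Real.norm_eq_abs, Real.norm_eq_abs,
        abs_of_pos (Real.rpow_pos_of_pos hz2 _)]
      have hin : ‖u z • ((α + N) * z.2 ^ (α + N - 1)) •
        ContinuousLinearMap.snd ℝ (Fin N → ℝ) ℝ + z.2 ^ (α + N) • fderiv ℝ u z‖ ≤
          |u z| * ((α + N) * z.2 ^ (α + N - 1)) + z.2 ^ (α + N) * ((N + 1) * gradNorm u z) := by
        refine (norm_add_le _ _).trans (add_le_add ?_ ?_)
        · rw [norm_smul, Real.norm_eq_abs]
          have := n1 (α + N)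
          rw [abs_of_pos hα] at this
          gcongr
        · rw [norm_smul, Real.norm_eq_abs, abs_of_pos (Real.rpow_pos_of_pos hz2 _)]
          gcongr
      calc _ ≤ z.2 ^ (-(N:ℝ)) * (|deriv F s| * (|u z| * ((α + N) * z.2 ^ (α + N - 1))
            + z.2 ^ (α + N) * ((N + 1) * gradNorm u z))) := by gcongr
        _ = (α + N) * (z.2 ^ (-(N:ℝ)) * (|u z| * z.2 ^ (α + N - 1))) * |deriv F s| +
            (z.2 ^ (-(N:ℝ)) * z.2 ^ (α + N)) * (N + 1) * gradNorm u z * |deriv F s| := by ring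
        _ = (α + N) * (z.2 ^ (-(N:ℝ) - 1) * (|s| * |deriv F s|)) +
            z.2 ^ α * (N + 1) * gradNorm u z * |deriv F s| := by rw [e1, e2]; ring
        _ ≤ (α + N) * (z.2 ^ (-(N:ℝ) - 1) * (B * |s| ^ r)) +
            z.2 ^ α * (N + 1) * gradNorm u z * B := by
              have k1 := hsd s
              have k2 := hdb s
              refine add_le_add ?_ ?_
              · exact mul_le_mul_of_nonneg_left (mul_le_mul_of_nonneg_left k1 (by positivity)) hα.le
              · exact mul_le_mul_of_nonneg_left k2 (by positivity)
        _ = (α + N) * B * (z.2 ^ (-(N:ℝ) - 1) * |s| ^ r) +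
            z.2 ^ α * (N + 1) * gradNorm u z * B := by ring
        _ = _ := by rw [hpow z hz]; ring
    have t2 : ‖F s • ((-(N:ℝ)) * z.2 ^ (-(N:ℝ) - 1)) • ContinuousLinearMap.snd ℝ (Fin N → ℝ) ℝ‖ ≤
        (N * B) * (z.2 ^ p * |u z| ^ r) := by
      rw [norm_smul, Real.norm_eq_abs]
      have := n1 (-(N:ℝ))
      rw [abs_neg, abs_of_pos hN0] at this
      calc _ ≤ (B * |s| ^ r) * (N * z.2 ^ (-(N:ℝ) - 1)) := by
            gcongr
            exact hFb s
        _ = (N * B) * (z.2 ^ (-(N:ℝ) - 1) * |s| ^ r) := by ring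
        _ = _ := by rw [hpow z hz]
    refine (add_le_add t1 t2).trans ?_
    have hA : 0 ≤ z.2 ^ α * gradNorm u z := by positivity
    have hB' : 0 ≤ z.2 ^ p * |u z| ^ r := by positivity
    have hc1 : 0 ≤ B * (N + 1) := by positivity
    have hc2 : 0 ≤ (α + N) * B + N * B := by positivity
    rw [hK]
    nlinarith [mul_nonneg hc1 hB', mul_nonneg hc2 hA]
  have hpt : ∀ z ∈ HS N, z.2 ^ (α * q) * |u z| ^ q ≤ z.2 ^ p * |u z| ^ r + |W z| ^ q := by
    intro z hz
    have hz2 : 0 < z.2 := hz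
    rw [hW, indicator_of_mem hz, ← hpow z hz, hV]
    dsimp only
    set s := u z * z.2 ^ (α + N) with hs
    have hNq : -(N:ℝ) * q = -(N:ℝ) - 1 := by rw [hq]; field_simp; ring
    have e : z.2 ^ (α * q) * |u z| ^ q = z.2 ^ (-(N:ℝ) - 1) * |s| ^ q := by
      rw [hs, abs_mul, abs_of_pos (Real.rpow_pos_of_pos hz2 _), Real.mul_rpow (abs_nonneg _) (by positivity),
        ← Real.rpow_mul hz2.le, mul_comm (|u z| ^ q), ← mul_assoc, ← Real.rpow_add hz2]
      congr 2
      linear_combination hNq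
    rw [e]
    by_cases h1 : 1 ≤ |s|
    · rw [hF1 s h1, abs_mul (z.2 ^ (-(N:ℝ))) s, abs_of_pos (Real.rpow_pos_of_pos hz2 (-(N:ℝ))), Real.mul_rpow (by positivity) (abs_nonneg _),
        ← Real.rpow_mul hz2.le, hNq]
      have : 0 ≤ z.2 ^ (-(N:ℝ) - 1) * |s| ^ r := by positivity
      linarith
    · have h2 : |s| ^ q ≤ |s| ^ r := by
        by_cases h0 : |s| = 0
        · rw [h0, Real.zero_rpow hq0.ne', Real.zero_rpow (by linarith)]
        · exact Real.rpow_le_rpow_of_exponent_ge (lt_of_le_of_ne (abs_nonneg _) (Ne.symm h0))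
            (not_le.1 h1).le hrq
      have h3 : z.2 ^ (-(N:ℝ) - 1) * |s| ^ q ≤ z.2 ^ (-(N:ℝ) - 1) * |s| ^ r := by gcongr
      have : 0 ≤ |z.2 ^ (-(N:ℝ)) * F s| ^ q := by positivity
      linarith
  have hGN := lintegral_pow_le_pow_lintegral_fderiv (volume : Measure ((Fin N → ℝ) × ℝ)) hWc hWs hconj
  have hmT : Measurable (fun z : (Fin N → ℝ) × ℝ => ENNReal.ofReal (z.2 ^ p * |u z| ^ r)) := by
    apply ENNReal.measurable_ofReal.comp
    apply (measurable_snd.pow_const p).mul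
    exact (hu.continuous.abs.measurable).pow_const r
  have hD : ∫⁻ z, ‖fderiv ℝ W z‖ₑ ≤ ENNReal.ofReal K * (MM α u + TT p r u) := by
    calc _ ≤ ∫⁻ z, (HS N).indicator (fun z => ENNReal.ofReal K *
          (ENNReal.ofReal (z.2 ^ α * gradNorm u z) + ENNReal.ofReal (z.2 ^ p * |u z| ^ r))) z := by
          apply lintegral_mono
          intro z
          dsimp only
          by_cases hz : z ∈ HS N
          · have hz2 : 0 < z.2 := hz
            have hg := grad_nonneg (u := u) z
            rw [indicator_of_mem hz, ← ofReal_norm, ← ENNReal.ofReal_add (by positivity) (by positivity),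
              ← ENNReal.ofReal_mul hK0.le]
            exact ENNReal.ofReal_le_ofReal (hder z hz)
          · rw [indicator_of_notMem hz, (hW0 z hz).fderiv_eq, ← ofReal_norm]
            simp
      _ = _ := by
          rw [lintegral_indicator measSet_HS, lintegral_const_mul' _ _ ofReal_ne_top,
            lintegral_add_right _ hmT]
          rfl
  calc TT (α * q) q u ≤ ∫⁻ z in HS N, (ENNReal.ofReal (z.2 ^ p * |u z| ^ r) + ‖W z‖ₑ ^ q) := by
        apply setLIntegral_mono' measSet_HS
        intro z hz
        have hz2 : 0 < z.2 := hz
        rw [← ofReal_norm, ENNReal.ofReal_rpow_of_nonneg (norm_nonneg _) hq0.le,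
          ← ENNReal.ofReal_add (by positivity) (by positivity)]
        exact ENNReal.ofReal_le_ofReal (hpt z hz)
    _ = TT p r u + ∫⁻ z in HS N, ‖W z‖ₑ ^ q := by
        rw [lintegral_add_left hmT]; rfl
    _ ≤ TT p r u + ∫⁻ z, ‖W z‖ₑ ^ q := by
        gcongr
        exact Measure.restrict_le_self
    _ ≤ TT p r u + lintegralPowLePowLIntegralFDerivConst (volume : Measure ((Fin N → ℝ) × ℝ)) q *
        (ENNReal.ofReal K * (MM α u + TT p r u)) ^ q := by
        gcongr
        refine hGN.trans ?_
        gcongr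
    _ = _ := by
        rw [ENNReal.mul_rpow_of_nonneg _ _ hq0.le, mul_assoc]

lemma grad_smul {N : ℕ} {u : ((Fin N → ℝ) × ℝ) → ℝ} (hu : ContDiff ℝ 1 u) (c : ℝ) (hc : 0 ≤ c)
    (z : (Fin N → ℝ) × ℝ) : gradNorm (fun z => c * u z) z = c * gradNorm u z := by
  have hd := (hu.differentiable (by norm_num)) z
  have h : fderiv ℝ (fun z => c * u z) z = c • fderiv ℝ u z := fderiv_const_mul hd c
  unfold gradNorm pX pY
  rw [h]
  simp only [ContinuousLinearMap.smul_apply, smul_eq_mul, mul_pow]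
  rw [← Finset.mul_sum, ← mul_add, Real.sqrt_mul (sq_nonneg c), Real.sqrt_sq hc]

lemma MM_smul {N : ℕ} {u : ((Fin N → ℝ) × ℝ) → ℝ} (hu : ContDiff ℝ 1 u) (α c : ℝ) (hc : 0 ≤ c) :
    MM α (fun z => c * u z) = ENNReal.ofReal c * MM α u := by
  unfold MM
  rw [← lintegral_const_mul' _ _ ofReal_ne_top]
  congr 1
  ext z
  rw [grad_smul hu c hc, ← ENNReal.ofReal_mul hc]
  congr 1; ring

lemma TT_smul {N : ℕ} {u : ((Fin N → ℝ) × ℝ) → ℝ} (p q c : ℝ) (hc : 0 ≤ c) (hq : 0 ≤ q) :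
    TT p q (fun z => c * u z) = ENNReal.ofReal c ^ q * TT p q u := by
  unfold TT
  rw [ENNReal.ofReal_rpow_of_nonneg hc hq, ← lintegral_const_mul' _ _ ofReal_ne_top]
  congr 1
  ext z
  rw [← ENNReal.ofReal_mul (by positivity), abs_mul, abs_of_nonneg hc, Real.mul_rpow hc (abs_nonneg _)]
  congr 1; ring

lemma crit (N : ℕ) (hN : 1 ≤ N) (α q : ℝ) (hq : q = ((N:ℝ) + 1) / N) (hα : -1 < α * q) :
    ∃ C : ℝ≥0∞, C ≠ ⊤ ∧ ∀ u : ((Fin N → ℝ) × ℝ) → ℝ, ContDiff ℝ 1 u → HasCompactSupport u →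
      MM α u ≠ ⊤ → TT (α * q) q u ≤ C * MM α u ^ q := by
  have hN0 : (0:ℝ) < N := by exact_mod_cast hN
  have hN1 : (1:ℝ) ≤ N := by exact_mod_cast hN
  have hq0 : 0 < q := by rw [hq]; positivity
  have hqN : q * N = N + 1 := by rw [hq]; field_simp
  have hq1 : 1 < q := by rw [hq, lt_div_iff₀ hN0]; linarith
  have hαN : 0 < α + N := by
    by_contra h
    nlinarith
  obtain ⟨r, hr1, hr2⟩ : ∃ r : ℝ, max 1 (N / (α + N)) < r ∧ r < q := by
    apply exists_between
    apply max_lt hq1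
    rw [div_lt_iff₀ hαN]
    nlinarith
  have hr3 : 1 < r := (le_max_left _ _).trans_lt hr1
  have hr4 : N < r * (α + N) := by
    rw [← div_lt_iff₀ hαN]; exact (le_max_right _ _).trans_lt hr1
  set p := α * r + N * r - N - 1 with hp
  obtain ⟨C0, hC0, h0⟩ := subcrit N α p r hr3.le (by nlinarith) (by rw [hp]; nlinarith) hp
  obtain ⟨C1, hC1, h1⟩ := crit_step N hN α q r p hq hr3.le hr2.le hαN hp
  refine ⟨C0 + C1 * (1 + C0) ^ q, ?_, ?_⟩
  · exact ENNReal.add_ne_top.2 ⟨hC0, ENNReal.mul_ne_top hC1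
      (ENNReal.rpow_ne_top_of_nonneg hq0.le (ENNReal.add_ne_top.2 ⟨one_ne_top, hC0⟩))⟩
  intro u hu hc hM
  by_cases hM0 : MM α u = 0
  · have h2 := h0 u hu hc
    rw [hM0, ENNReal.zero_rpow_of_pos (by linarith), mul_zero] at h2
    have h2' : TT p r u = 0 := le_antisymm h2 bot_le
    have h3 := h1 u hu hc
    rw [hM0, h2', zero_add, add_zero, ENNReal.zero_rpow_of_pos hq0, mul_zero] at h3
    exact h3.trans bot_le
  · set m := (MM α u).toReal with hm
    have hm0 : 0 < m := ENNReal.toReal_pos hM0 hM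
    have hmM : ENNReal.ofReal m = MM α u := ENNReal.ofReal_toReal hM
    have hinv : ENNReal.ofReal m⁻¹ * MM α u = 1 := by
      rw [← hmM, ← ENNReal.ofReal_mul (by positivity), inv_mul_cancel₀ hm0.ne', ENNReal.ofReal_one]
    have hv : ContDiff ℝ 1 (fun z => m⁻¹ * u z) := contDiff_const.mul hu
    have hvc : HasCompactSupport (fun z => m⁻¹ * u z) := hc.mul_left
    have hMv : MM α (fun z => m⁻¹ * u z) = 1 := by
      rw [MM_smul hu α m⁻¹ (by positivity), hinv]
    have h2 := h0 _ hv hvc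
    rw [hMv, ENNReal.one_rpow, mul_one] at h2
    have h3 := h1 _ hv hvc
    rw [hMv, TT_smul (α * q) q m⁻¹ (by positivity) hq0.le] at h3
    have h4 : ENNReal.ofReal m⁻¹ ^ q * TT (α * q) q u ≤ C0 + C1 * (1 + C0) ^ q := by
      refine h3.trans ?_
      gcongr
    calc TT (α * q) q u = (ENNReal.ofReal m⁻¹ * MM α u) ^ q * TT (α * q) q u := by
          rw [hinv, ENNReal.one_rpow, one_mul]
      _ = (ENNReal.ofReal m⁻¹ ^ q * TT (α * q) q u) * MM α u ^ q := by
          rw [ENNReal.mul_rpow_of_nonneg _ _ hq0.le]; ring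
      _ ≤ _ := by gcongr

lemma MM_fin {N : ℕ} (α : ℝ) (hα : -1 < α) {u : ((Fin N → ℝ) × ℝ) → ℝ} (hu : ContDiff ℝ 1 u)
    (hc : HasCompactSupport u) : MM α u ≠ ⊤ := by
  have hg := grad_cont hu
  obtain ⟨R, hR⟩ := hc.isCompact.isBounded.subset_closedBall 0
  have hgs : ∀ z, gradNorm u z ≠ 0 → ‖z‖ ≤ R := by
    intro z hz
    by_contra h
    apply hz
    have h1 : z ∉ tsupport u := fun h2 => h (by simpa using hR h2)
    have h2 : fderiv ℝ u z = 0 := by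
      by_contra h3
      exact h1 (support_fderiv_subset ℝ h3)
    unfold gradNorm pX pY
    rw [h2]
    simp
  have hgc : HasCompactSupport (gradNorm u) := by
    apply HasCompactSupport.intro (isCompact_closedBall (0 : (Fin N → ℝ) × ℝ) R)
    intro z hz
    by_contra h
    exact hz (by simpa using hgs z h)
  obtain ⟨D, hD⟩ := hg.bounded_above_of_compact_support hgc
  set f : (Fin N → ℝ) → ℝ≥0∞ := (Metric.closedBall 0 R).indicator (fun _ => ENNReal.ofReal D) with hf
  set g : ℝ → ℝ≥0∞ := (Ioc 0 R).indicator (fun y => ENNReal.ofReal (y ^ α)) with hgd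
  have hfm : Measurable f := measurable_const.indicator Metric.isClosed_closedBall.measurableSet
  have hgm : Measurable g := by
    apply Measurable.indicator _ measurableSet_Ioc
    fun_prop
  have hle : MM α u ≤ ∫⁻ z : (Fin N → ℝ) × ℝ, f z.1 * g z.2 := by
    unfold MM
    rw [← lintegral_indicator measSet_HS]
    apply lintegral_mono
    intro z
    dsimp only
    by_cases hz : z ∈ HS N
    · rw [indicator_of_mem hz]
      have hz2 : 0 < z.2 := hz
      by_cases h0 : gradNorm u z = 0
      · rw [h0, mul_zero, ENNReal.ofReal_zero]; exact bot_le
      · have h1 := hgs z h0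
        have h2 : z.1 ∈ Metric.closedBall (0 : Fin N → ℝ) R := by
          simpa using (norm_fst_le z).trans h1
        have h3 : z.2 ∈ Ioc 0 R := ⟨hz2, (le_abs_self _).trans ((norm_snd_le z).trans h1)⟩
        rw [hf, hgd, indicator_of_mem h2, indicator_of_mem h3, mul_comm,
          ENNReal.ofReal_mul (grad_nonneg z)]
        gcongr
        exact (le_abs_self _).trans (hD z)
    · rw [indicator_of_notMem hz]; exact bot_le
  refine ne_of_lt (hle.trans_lt ?_)
  rw [Measure.volume_eq_prod, lintegral_prod_mul hfm.aemeasurable hgm.aemeasurable]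
  apply ENNReal.mul_lt_top
  · rw [hf, lintegral_indicator Metric.isClosed_closedBall.measurableSet, setLIntegral_const]
    exact ENNReal.mul_lt_top ofReal_lt_top (measure_closedBall_lt_top)
  · rw [hgd, lintegral_indicator measurableSet_Ioc]
    by_cases hR0 : 0 ≤ R
    · have hi := (intervalIntegral.intervalIntegrable_rpow' (a := 0) (b := R) hα)
      rw [intervalIntegrable_iff_integrableOn_Ioc_of_le hR0] at hi
      have := hi.2
      rw [hasFiniteIntegral_iff_enorm] at this
      refine lt_of_le_of_lt (lintegral_mono fun y => ?_) this
      rw [← ofReal_norm]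
      exact ENNReal.ofReal_le_ofReal (le_abs_self _)
    · rw [Ioc_eq_empty (by linarith)]; simp

/-- weighted `L¹` Sobolev inequality of Maz'ya type: if
`1 ≤ q ≤ (N+1)/N` and `β = α − 1 + ((q−1)/q)(N+1) > −1/q`, then
`‖y^β u‖_{L^q} ≤ C ‖y^α ∇u‖_{L¹}` for smooth compactly supported `u` on the
closed half-space. -/
theorem stmt_2 (N : ℕ) (hN : 1 ≤ N) (α q : ℝ) (hq1 : 1 ≤ q) (hq2 : q ≤ ((N : ℝ) + 1) / N)
    (β : ℝ) (hβ : β = α - 1 + ((q - 1) / q) * ((N : ℝ) + 1)) (hβ' : β > -(1 / q)) :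
    ∃ C > 0, ∀ u : ((Fin N → ℝ) × ℝ) → ℝ, ContDiff ℝ (⊤ : ℕ∞) u → HasCompactSupport u →
      (∫ z in HS N, z.2 ^ (β * q) * |u z| ^ q) ^ (1 / q) ≤
        C * ∫ z in HS N, z.2 ^ α * gradNorm u z := by
  have hN0 : (0:ℝ) < N := by exact_mod_cast hN
  have hq0 : 0 < q := by linarith
  have hp : β * q = α * q + N * q - N - 1 := by
    rw [hβ]; field_simp; ring
  have hp1 : -1 < β * q := by
    have := mul_lt_mul_of_pos_right hβ' hq0
    rwa [neg_mul, one_div_mul_cancel hq0.ne'] at this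
  have hqN : q * N ≤ N + 1 := by rwa [le_div_iff₀ hN0] at hq2
  have hα : -1 < α := by
    by_contra h
    nlinarith
  obtain ⟨C, hC, hmain⟩ : ∃ C : ℝ≥0∞, C ≠ ⊤ ∧ ∀ u : ((Fin N → ℝ) × ℝ) → ℝ, ContDiff ℝ 1 u →
      HasCompactSupport u → MM α u ≠ ⊤ → TT (β * q) q u ≤ C * MM α u ^ q := by
    rcases lt_or_eq_of_le hqN with h | h
    · obtain ⟨C, hC, h1⟩ := subcrit N α (β * q) q hq1 h hp1 hp
      exact ⟨C, hC, fun u hu hc _ => h1 u hu hc⟩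
    · have e : β * q = α * q := by rw [hp]; linarith
      rw [e]
      apply crit N hN α q _ (by rw [← e]; exact hp1)
      rw [eq_div_iff hN0.ne', h]
  refine ⟨C.toReal ^ (1 / q) + 1, by positivity, ?_⟩
  intro u hu hc
  have hu1 : ContDiff ℝ 1 u := hu.of_le (by exact_mod_cast le_top)
  have hM := MM_fin α hα hu1 hc
  have h := hmain u hu1 hc hM
  have hL : ∫ z in HS N, z.2 ^ (β * q) * |u z| ^ q = (TT (β * q) q u).toReal := by
    unfold TT
    apply integral_eq_lintegral_of_nonneg_ae
    · filter_upwards [ae_restrict_mem measSet_HS] with z hz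
      have hz2 : 0 < z.2 := hz
      simp only [Pi.zero_apply]
      positivity
    · apply Measurable.aestronglyMeasurable
      apply (measurable_snd.pow_const _).mul
      exact (hu.continuous.abs.measurable).pow_const q
  have hRt : ∫ z in HS N, z.2 ^ α * gradNorm u z = (MM α u).toReal := by
    unfold MM
    apply integral_eq_lintegral_of_nonneg_ae
    · filter_upwards [ae_restrict_mem measSet_HS] with z hz
      have hz2 : 0 < z.2 := hz
      have := grad_nonneg (u := u) z
      simp only [Pi.zero_apply]
      positivity
    · apply Measurable.aestronglyMeasurable
      exact (measurable_snd.pow_const _).mul (grad_cont hu1).measurable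
  rw [hL, hRt]
  have h2 : (TT (β * q) q u).toReal ≤ C.toReal * (MM α u).toReal ^ q := by
    have := ENNReal.toReal_mono (ENNReal.mul_ne_top hC (ENNReal.rpow_ne_top_of_nonneg hq0.le hM)) h
    rwa [ENNReal.toReal_mul, ← ENNReal.toReal_rpow] at this
  have hm0 : 0 ≤ (MM α u).toReal := ENNReal.toReal_nonneg
  calc (TT (β * q) q u).toReal ^ (1 / q) ≤ (C.toReal * (MM α u).toReal ^ q) ^ (1 / q) := by
        gcongr
    _ = C.toReal ^ (1 / q) * (MM α u).toReal := by
        rw [Real.mul_rpow ENNReal.toReal_nonneg (by positivity), ← Real.rpow_mul hm0,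
          mul_one_div_cancel hq0.ne', Real.rpow_one]
    _ ≤ _ := by nlinarith
end
end

section
/- Let N ≥ 1 and let q, β, α ∈ ℝ satisfy: (i) 2 ≤ q ≤ 2(N+1)/(N−1) if N > 1, or simply q ≥ 2 if N = 1; (ii) β + 1/q > 0; (iii) β = α − 1 + (N+1)(1/2 − 1/q). Then there exists a constant C > 0 such that for every u ∈ C_c^∞(cl(ℝ^{N+1}_+)) one has (∫_{ℝ^{N+1}_+} y^{βq} |u(x,y)|^q dx dy)^{1/q} ≤ C (∫_{ℝ^{N+1}_+} y^{2α} |∇u(x,y)|² dx dy)^{1/2}. -/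
open MeasureTheory Real

noncomputable section

open Set

/-- shorthand for the ambient space -/
abbrev EE (N : ℕ) := (Fin N → ℝ) × ℝ

/-- weight `y^c` -/
def W {N : ℕ} (c : ℝ) (z : EE N) : ENNReal := ENNReal.ofReal (z.2 ^ c)

/-- vertical scaling -/
def S {N : ℕ} (l : ℝ) (z : EE N) : EE N := (z.1, l * z.2)

lemma W_meas {N : ℕ} (c : ℝ) : Measurable (W c : EE N → ENNReal) := by
  unfold W
  exact ENNReal.measurable_ofReal.comp (measurable_snd.pow_const c)

lemma HS_meas (N : ℕ) : MeasurableSet (HS N) := measurableSet_lt measurable_const measurable_snd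

lemma W_mul {N : ℕ} (c d : ℝ) {z : EE N} (hz : z ∈ HS N) : W c z * W d z = W (c + d) z := by
  have hz : 0 < z.2 := hz
  unfold W
  rw [← ENNReal.ofReal_mul (by positivity), Real.rpow_add hz]

lemma W_pow {N : ℕ} (c r : ℝ) {z : EE N} (hz : z ∈ HS N) : W c z ^ r = W (c * r) z := by
  have hz : 0 < z.2 := hz
  unfold W
  rw [ENNReal.ofReal_rpow_of_pos (by positivity), Real.rpow_mul hz.le]

lemma W_zero {N : ℕ} (z : EE N) : W 0 z = 1 := by simp [W]

lemma W_S {N : ℕ} (c : ℝ) {l : ℝ} (hl : 0 < l) {z : EE N} (hz : z ∈ HS N) :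
    W c (S l z) = ENNReal.ofReal (l ^ c) * W c z := by
  have hz : 0 < z.2 := hz
  unfold W S
  simp only
  rw [← ENNReal.ofReal_mul (by positivity), Real.mul_rpow hl.le hz.le]

lemma haarE (N : ℕ) : (volume : Measure (EE N)).IsAddHaarMeasure := by
  rw [Measure.volume_eq_prod]; infer_instance

lemma S_meas {N : ℕ} (l : ℝ) : Measurable (S l : EE N → EE N) := by
  unfold S; fun_prop

lemma scale {N : ℕ} {l : ℝ} (hl : 0 < l) (F : EE N → ENNReal) (hF : Measurable F) :
    ∫⁻ z in HS N, F (S l z) = ENNReal.ofReal l⁻¹ * ∫⁻ z in HS N, F z := by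
  have key : ∀ G : EE N → ENNReal, Measurable G →
      ∫⁻ z, G (S l z) = ENNReal.ofReal l⁻¹ * ∫⁻ z, G z := by
    intro G hG
    rw [Measure.volume_eq_prod, lintegral_prod _ hG.aemeasurable,
      lintegral_prod (fun z => G (S l z)) (hG.comp (S_meas l)).aemeasurable, ← lintegral_const_mul _
        (hG.lintegral_prod_right')]
    congr 1; ext x
    have h := Real.map_volume_mul_left hl.ne'
    have h2 : ∫⁻ y, G (x, y) ∂(Measure.map (fun y => l * y) volume) = ∫⁻ y, G (x, l * y) :=
      lintegral_map (by fun_prop) (by fun_prop)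
    rw [h, lintegral_smul_measure, abs_of_pos (by positivity)] at h2
    simpa [S] using h2.symm
  rw [← lintegral_indicator (HS_meas N), ← lintegral_indicator (HS_meas N),
    ← key _ (hF.indicator (HS_meas N))]
  congr 1; ext z
  by_cases hz : z ∈ HS N
  · have : S l z ∈ HS N := mul_pos hl hz
    simp [hz, this]
  · have : S l z ∉ HS N := by
      intro h
      exact hz (pos_of_mul_pos_right (show 0 < l * z.2 from h) hl.le)
    simp [hz, this]

lemma scaleW {N : ℕ} {l : ℝ} (hl : 0 < l) (c : ℝ) (F : EE N → ENNReal) (hF : Measurable F) :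
    ∫⁻ z in HS N, W c z * F (S l z) = ENNReal.ofReal (l ^ (-c - 1)) * ∫⁻ z in HS N, W c z * F z := by
  have h := scale hl (fun z => W c z * F z) ((W_meas c).mul hF)
  have h1 : ∫⁻ z in HS N, W c z * F (S l z)
      = ∫⁻ z in HS N, ENNReal.ofReal (l ^ (-c)) * (W c (S l z) * F (S l z)) := by
    refine setLIntegral_congr_fun (HS_meas N) fun z hz => ?_
    rw [W_S c hl hz, ← mul_assoc, ← mul_assoc, ← ENNReal.ofReal_mul (by positivity),
      ← Real.rpow_add hl]
    simp
  have hm : Measurable (fun z => W c (S l z) * F (S l z)) :=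
    ((W_meas c).mul hF).comp (S_meas l)
  rw [h1, lintegral_const_mul _ hm, h, ← mul_assoc,
    ← ENNReal.ofReal_mul (by positivity), sub_eq_add_neg, Real.rpow_add hl, Real.rpow_neg_one]

lemma W_fin {N : ℕ} {c : ℝ} (hc : -1 < c) (F : EE N → ENNReal) {M : ENNReal} (hM : M ≠ ⊤)
    (hF : ∀ z, F z ≤ M) {R : ℝ} (hR : ∀ z, R < ‖z‖ → F z = 0) :
    ∫⁻ z in HS N, W c z * F z < ⊤ := by
  have hS : MeasurableSet (Ioc (0:ℝ) |R|) := measurableSet_Ioc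
  have h1 : ∫⁻ z in HS N, W c z * F z ≤ ∫⁻ z : EE N,
      ((Metric.closedBall (0 : Fin N → ℝ) |R|).indicator (fun _ => M) z.1) *
        ((Ioc (0:ℝ) |R|).indicator (fun y => ENNReal.ofReal (y ^ c)) z.2) := by
    rw [← lintegral_indicator (HS_meas N)]
    refine lintegral_mono fun z => ?_
    by_cases hz : z ∈ HS N
    · have hz' : 0 < z.2 := hz
      by_cases hn : R < ‖z‖
      · rw [indicator_of_mem hz, hR z hn]; simp
      · have hn' : ‖z‖ ≤ |R| := (not_lt.1 hn).trans (le_abs_self R)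
        have ha : ‖z.1‖ ≤ |R| := (norm_fst_le z).trans hn'
        have hb : z.2 ≤ |R| := (le_abs_self _).trans ((norm_snd_le z).trans hn')
        have ha' : z.1 ∈ Metric.closedBall (0 : Fin N → ℝ) |R| := by simpa using ha
        have hb' : z.2 ∈ Ioc 0 |R| := ⟨hz', hb⟩
        rw [indicator_of_mem hz, indicator_of_mem ha', indicator_of_mem hb', mul_comm]
        exact mul_le_mul_left (hF z) _
    · simp [hz]
  refine h1.trans_lt ?_
  rw [Measure.volume_eq_prod, lintegral_prod_mul]
  · refine ENNReal.mul_lt_top ?_ ?_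
    · rw [lintegral_indicator Metric.isClosed_closedBall.measurableSet, setLIntegral_const]
      exact ENNReal.mul_lt_top hM.lt_top measure_closedBall_lt_top
    · rw [lintegral_indicator hS]
      have := (intervalIntegrable_iff_integrableOn_Ioc_of_le (abs_nonneg R)).1
        (intervalIntegral.intervalIntegrable_rpow' (a := 0) (b := |R|) hc)
      exact this.lintegral_lt_top
  · exact (measurable_const.indicator Metric.isClosed_closedBall.measurableSet).aemeasurable
  · exact (Measurable.indicator (by fun_prop) hS).aemeasurable

lemma hardy {N : ℕ} (a : ℝ) (v : EE N → ℝ) (hv : ContDiff ℝ 1 v) :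
    ∫⁻ z in HS N, W (a - 1) z * ‖v z - v (S 2 z)‖ₑ ≤
      ENNReal.ofReal (2 ^ |a + 1|) * ∫⁻ z in HS N, W a z * ‖fderiv ℝ v z‖ₑ := by
  have hA : Continuous (fun z => fderiv ℝ v z) := hv.continuous_fderiv one_ne_zero
  have hAm : Measurable (fun z => ‖fderiv ℝ v z‖ₑ) := hA.enorm.measurable
  have hSc : Continuous (fun p : EE N × ℝ => S p.2 p.1) := by unfold S; fun_prop
  have pt : ∀ z ∈ HS N, W (a - 1) z * ‖v z - v (S 2 z)‖ₑ ≤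
      ∫⁻ l in Ioc (1:ℝ) 2, W a z * ‖fderiv ℝ v (S l z)‖ₑ := by
    intro z hz
    have hz' : 0 < z.2 := hz
    have hSl : Continuous (fun l : ℝ => S l z) := by unfold S; fun_prop
    have hd : ∀ l ∈ uIcc (1:ℝ) 2, HasDerivAt (fun l => v (S l z))
        (fderiv ℝ v (S l z) (0, z.2)) l := by
      intro l _
      have h1 : HasDerivAt (fun l : ℝ => S l z) ((0 : Fin N → ℝ), z.2) l := by
        unfold S
        refine (hasDerivAt_const l z.1).prodMk ?_
        simpa using (hasDerivAt_id l).mul_const z.2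
      exact ((hv.differentiable one_ne_zero) (S l z)).hasFDerivAt.comp_hasDerivAt l h1
    have hcd : Continuous (fun l : ℝ => fderiv ℝ v (S l z) ((0 : Fin N → ℝ), z.2)) :=
      (hA.comp hSl).clm_apply continuous_const
    have hi := intervalIntegral.integral_eq_sub_of_hasDerivAt hd (hcd.intervalIntegrable _ _)
    have h1 : S 1 z = z := by simp [S]
    rw [h1, intervalIntegral.integral_of_le (by norm_num)] at hi
    have h2 : ‖v z - v (S 2 z)‖ₑ ≤ ∫⁻ l in Ioc (1:ℝ) 2, W 1 z * ‖fderiv ℝ v (S l z)‖ₑ := by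
      rw [← enorm_neg, neg_sub, ← hi]
      refine (enorm_integral_le_lintegral_enorm _).trans (lintegral_mono fun l => ?_)
      refine (ContinuousLinearMap.le_opENorm _ _).trans ?_
      rw [mul_comm]
      refine mul_le_mul_left ?_ _
      rw [← ofReal_norm]
      refine ENNReal.ofReal_le_ofReal ?_
      simp [Prod.norm_def, abs_of_pos hz', hz'.le]
    have hm : Measurable (fun l : ℝ => ‖fderiv ℝ v (S l z)‖ₑ) := (hA.comp hSl).enorm.measurable
    calc _ ≤ W (a-1) z * ∫⁻ l in Ioc (1:ℝ) 2, W 1 z * ‖fderiv ℝ v (S l z)‖ₑ := by gcongr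
      _ = _ := by
        rw [lintegral_const_mul _ hm, lintegral_const_mul _ hm, ← mul_assoc, W_mul _ _ hz]
        simp
  calc _ ≤ ∫⁻ z in HS N, ∫⁻ l in Ioc (1:ℝ) 2, W a z * ‖fderiv ℝ v (S l z)‖ₑ :=
        setLIntegral_mono' (HS_meas N) pt
    _ = ∫⁻ l in Ioc (1:ℝ) 2, ∫⁻ z in HS N, W a z * ‖fderiv ℝ v (S l z)‖ₑ := by
        rw [lintegral_lintegral_swap]
        refine Measurable.aemeasurable ?_
        exact ((W_meas a).comp measurable_fst).mul (hA.comp hSc).enorm.measurable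
    _ ≤ ∫⁻ l in Ioc (1:ℝ) 2, ENNReal.ofReal (2 ^ |a + 1|) *
          ∫⁻ z in HS N, W a z * ‖fderiv ℝ v z‖ₑ := by
        refine setLIntegral_mono' measurableSet_Ioc fun l hl => ?_
        have hl0 : 0 < l := by linarith [hl.1]
        rw [scaleW hl0 a _ hAm]
        gcongr
        calc l ^ (-a - 1) ≤ l ^ |a + 1| :=
              Real.rpow_le_rpow_of_exponent_le hl.1.le (by
                have := neg_abs_le (a + 1); linarith)
          _ ≤ 2 ^ |a + 1| := Real.rpow_le_rpow hl0.le hl.2 (abs_nonneg _)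
    _ = _ := by rw [setLIntegral_const]; norm_num

lemma cutoff_s3 (a : ℝ) : ∃ K : ℝ, 0 ≤ K ∧ ∀ ε : ℝ, 0 < ε → ∃ ψ : ℝ → ℝ, ContDiff ℝ 1 ψ ∧
    (∀ y, y ≤ ε → ψ y = 0) ∧ (∀ y, 0 < y → |ψ y| ≤ y ^ a) ∧
    (∀ y, 0 < y → |deriv ψ y| ≤ K * y ^ (a - 1)) ∧ (∀ y, 2 * ε ≤ y → ψ y = y ^ a) := by
  have hτ : ContDiff ℝ 1 Real.smoothTransition := Real.smoothTransition.contDiff (n := 1)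
  have hτ' : Continuous (deriv Real.smoothTransition) := hτ.continuous_deriv le_rfl
  obtain ⟨K0, hK0⟩ := (isCompact_Icc (a := (0:ℝ)) (b := 1)).exists_bound_of_continuousOn
    hτ'.continuousOn
  have hK00 : 0 ≤ K0 := (norm_nonneg _).trans (hK0 0 (by simp))
  refine ⟨2 * K0 + |a|, by positivity, fun ε hε => ?_⟩
  have hz : ∀ y, y ≤ ε → Real.smoothTransition (y / ε - 1) * y ^ a = 0 := by
    intro y hy
    rw [Real.smoothTransition.zero_of_nonpos, zero_mul]
    have : y / ε ≤ 1 := (div_le_one hε).2 hy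
    linarith
  have ho : ∀ y, 2 * ε ≤ y → Real.smoothTransition (y / ε - 1) * y ^ a = y ^ a := by
    intro y hy
    rw [Real.smoothTransition.one_of_one_le, one_mul]
    have : 2 ≤ y / ε := (le_div_iff₀ hε).2 hy
    linarith
  refine ⟨fun y => Real.smoothTransition (y / ε - 1) * y ^ a, ?_, hz, ?_, ?_, ho⟩
  · rw [contDiff_iff_contDiffAt]
    intro y
    rcases lt_or_ge y ε with h | h
    · have : (fun y => Real.smoothTransition (y / ε - 1) * y ^ a) =ᶠ[nhds y] fun _ => (0:ℝ) := by
        filter_upwards [Iio_mem_nhds h] with t ht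
        exact hz t (le_of_lt ht)
      exact (contDiffAt_const (c := (0:ℝ))).congr_of_eventuallyEq this
    · have hy : 0 < y := hε.trans_le h
      refine ContDiffAt.mul ?_ ?_
      · exact (hτ.comp (by fun_prop : ContDiff ℝ 1 (fun y : ℝ => y / ε - 1))).contDiffAt
      · exact Real.contDiffAt_rpow_const_of_ne hy.ne'
  · intro y hy
    have h0 : 0 ≤ y ^ a := by positivity
    rw [abs_mul, abs_of_nonneg (Real.smoothTransition.nonneg _), abs_of_nonneg h0]
    exact mul_le_of_le_one_left h0 (Real.smoothTransition.le_one _)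
  · intro y hy
    have h1 : 0 < y ^ (a - 1) := by positivity
    have hd : HasDerivAt (fun y : ℝ => y ^ a) (a * y ^ (a - 1)) y :=
      Real.hasDerivAt_rpow_const (Or.inl hy.ne')
    rcases lt_or_ge y ε with h | h
    · have : (fun y => Real.smoothTransition (y / ε - 1) * y ^ a) =ᶠ[nhds y] fun _ => (0:ℝ) := by
        filter_upwards [Iio_mem_nhds h] with t ht
        exact hz t (le_of_lt ht)
      rw [this.deriv_eq]
      simp only [deriv_const, abs_zero]
      positivity
    rcases lt_or_ge (2 * ε) y with h' | h'
    · have : (fun y => Real.smoothTransition (y / ε - 1) * y ^ a) =ᶠ[nhds y] fun y => y ^ a := by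
        filter_upwards [Ioi_mem_nhds h'] with t ht
        exact ho t (le_of_lt ht)
      rw [this.deriv_eq, hd.deriv, abs_mul, abs_of_pos h1]
      gcongr
      linarith
    · have ht : HasDerivAt (fun y : ℝ => Real.smoothTransition (y / ε - 1))
          (deriv Real.smoothTransition (y / ε - 1) * (1 / ε)) y := by
        have hi : HasDerivAt (fun y : ℝ => y / ε - 1) (1 / ε) y :=
          ((hasDerivAt_id y).div_const ε).sub_const 1
        exact ((hτ.differentiable one_ne_zero) _).hasDerivAt.comp y hi
      have hmul : HasDerivAt (fun y : ℝ => Real.smoothTransition (y / ε - 1) * y ^ a)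
        (deriv Real.smoothTransition (y / ε - 1) * (1 / ε) * y ^ a +
          Real.smoothTransition (y / ε - 1) * (a * y ^ (a - 1))) y := ht.mul hd
      rw [hmul.deriv]
      have hm : y / ε - 1 ∈ Icc (0:ℝ) 1 := by
        constructor
        · have : 1 ≤ y / ε := (le_div_iff₀ hε).2 (by linarith)
          linarith
        · have : y / ε ≤ 2 := (div_le_iff₀ hε).2 h'
          linarith
      have hb := hK0 _ hm
      rw [Real.norm_eq_abs] at hb
      have hya : y ^ a = y ^ (a - 1) * y := by
        rw [← Real.rpow_add_one hy.ne']; simp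
      have hye : y * (1 / ε) ≤ 2 := by
        rw [mul_one_div]; exact (div_le_iff₀ hε).2 h'
      have e1 : |deriv Real.smoothTransition (y / ε - 1) * (1 / ε) * y ^ a| ≤
          2 * K0 * y ^ (a - 1) := by
        rw [hya, abs_mul, abs_mul, abs_mul, abs_of_pos h1, abs_of_pos hy,
          abs_of_pos (show 0 < 1 / ε by positivity)]
        calc _ = |deriv Real.smoothTransition (y / ε - 1)| * (y * (1 / ε)) * y ^ (a - 1) := by ring
          _ ≤ K0 * 2 * y ^ (a - 1) := by gcongr
          _ = _ := by ring
      have e2 : |Real.smoothTransition (y / ε - 1) * (a * y ^ (a - 1))| ≤ |a| * y ^ (a - 1) := by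
        rw [abs_mul, abs_of_nonneg (Real.smoothTransition.nonneg _), abs_mul, abs_of_pos h1]
        exact mul_le_of_le_one_left (by positivity) (Real.smoothTransition.le_one _)
      refine (abs_add_le _ _).trans ?_
      linarith

lemma sobolev {N : ℕ} (hN : 1 ≤ N) (a : ℝ) : ∃ C : ENNReal, C ≠ ⊤ ∧ ∀ v : EE N → ℝ,
    ContDiff ℝ 1 v → HasCompactSupport v →
    ∫⁻ z in HS N, (W a z * ‖v z - v (S 2 z)‖ₑ) ^ (((N:ℝ) + 1) / N) ≤
      C * (∫⁻ z in HS N, W a z * ‖fderiv ℝ v z‖ₑ) ^ (((N:ℝ) + 1) / N) := by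
  obtain ⟨K, hK, hcut⟩ := cutoff_s3 a
  set r : ℝ := ((N:ℝ) + 1) / N with hr
  have hN' : (1:ℝ) ≤ N := by exact_mod_cast hN
  have hr0 : 0 ≤ r := by positivity
  have := haarE N
  set M : ENNReal :=
    ((lintegralPowLePowLIntegralFDerivConst (volume : Measure (EE N)) r : NNReal) : ENNReal) with hMdef
  set B : ENNReal := ENNReal.ofReal K * ENNReal.ofReal (2 ^ |a + 1|) +
    (1 + 2 * ENNReal.ofReal (2 ^ (-a - 1))) with hB
  refine ⟨M * B ^ r, ?_, fun v hv hvc => ?_⟩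
  · refine ENNReal.mul_ne_top (by simp [hMdef]) (ENNReal.rpow_ne_top_of_nonneg hr0 ?_)
    simp [hB, ENNReal.mul_eq_top]
  set G : ENNReal := ∫⁻ z in HS N, W a z * ‖fderiv ℝ v z‖ₑ with hG
  have hA : Continuous (fun z => fderiv ℝ v z) := hv.continuous_fderiv one_ne_zero
  have hAm : Measurable (fun z => ‖fderiv ℝ v z‖ₑ) := hA.enorm.measurable
  let L : EE N →L[ℝ] EE N := (ContinuousLinearMap.fst ℝ _ _).prod
    ((2:ℝ) • ContinuousLinearMap.snd ℝ _ _)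
  have hL : ∀ z, S 2 z = L z := fun z => by simp [S, L]
  have hLn : ‖L‖ ≤ 2 := by
    refine L.opNorm_le_bound (by norm_num) fun z => ?_
    rw [← hL]
    simp only [S, Prod.norm_def, norm_mul, Real.norm_ofNat]
    have := norm_nonneg z.1
    refine max_le ?_ ?_
    · nlinarith [le_max_left ‖z.1‖ ‖z.2‖]
    · nlinarith [le_max_right ‖z.1‖ ‖z.2‖]
  have hvS : ContDiff ℝ 1 (fun z => v (S 2 z)) := by
    simp_rw [hL]; exact hv.comp L.contDiff
  have hD : ContDiff ℝ 1 (fun z => v z - v (S 2 z)) := hv.sub hvS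
  have hSm : Measurable (fun z : EE N => ‖fderiv ℝ v (S 2 z)‖ₑ) := hAm.comp (S_meas 2)
  obtain ⟨R, hR⟩ := hvc.isCompact.isBounded.exists_norm_le
  have hR' : ∀ z, R < ‖z‖ → v z = 0 := by
    intro z hz
    by_contra h
    exact absurd (hR z (subset_tsupport _ h)) (not_le.2 hz)
  have hSn : ∀ z : EE N, ‖z‖ ≤ ‖S 2 z‖ := by
    intro z
    simp only [S, Prod.norm_def, norm_mul, Real.norm_ofNat]
    refine max_le_max le_rfl ?_
    linarith [norm_nonneg z.2]
  have main : ∀ ε : ℝ, 0 < ε → ∫⁻ z in {z : EE N | 2 * ε ≤ z.2},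
      (W a z * ‖v z - v (S 2 z)‖ₑ) ^ r ≤ M * B ^ r * G ^ r := by
    intro ε hε
    obtain ⟨ψ, hψ, hψ0, hψ1, hψ2, hψ3⟩ := hcut ε hε
    let f : EE N → ℝ := fun z => ψ z.2 * (v z - v (S 2 z))
    have hf : ContDiff ℝ 1 f := (hψ.comp contDiff_snd).mul hD
    have hfc : HasCompactSupport f := by
      refine HasCompactSupport.intro (isCompact_closedBall (0 : EE N) R) fun z hz => ?_
      have hz' : R < ‖z‖ := by simpa using hz
      simp [f, hR' z hz', hR' _ (hz'.trans_le (hSn z))]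
    have hs := lintegral_pow_le_pow_lintegral_fderiv (volume : Measure (EE N)) hf hfc (p := r) (by
      have : (Module.finrank ℝ (EE N) : ℝ) = N + 1 := by simp
      rw [this, Real.holderConjugate_iff]
      refine ⟨by linarith, ?_⟩
      rw [hr]; field_simp; ring)
    have h1 : ∫⁻ z in {z : EE N | 2 * ε ≤ z.2}, (W a z * ‖v z - v (S 2 z)‖ₑ) ^ r ≤
        ∫⁻ z, ‖f z‖ₑ ^ r := by
      refine le_trans ?_ (setLIntegral_le_lintegral {z : EE N | 2 * ε ≤ z.2} _)
      refine le_of_eq (setLIntegral_congr_fun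
        (measurableSet_le measurable_const measurable_snd) fun z hz => ?_)
      have hz : 2 * ε ≤ z.2 := hz
      simp only [f]
      rw [hψ3 _ hz, enorm_mul]
      congr 2
      rw [W, Real.enorm_eq_ofReal]
      have : 0 < z.2 := by linarith
      positivity
    have h2 : ∫⁻ z, ‖fderiv ℝ f z‖ₑ ≤ B * G := by
      have hsupp : ∫⁻ z, ‖fderiv ℝ f z‖ₑ = ∫⁻ z in HS N, ‖fderiv ℝ f z‖ₑ := by
        rw [← lintegral_indicator (HS_meas N)]
        congr 1; ext z
        by_cases hz : z ∈ HS N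
        · simp [hz]
        · rw [indicator_of_notMem hz]
          have hz' : z.2 ≤ 0 := not_lt.1 hz
          have : f =ᶠ[nhds z] fun _ => (0:ℝ) := by
            have ho : {w : EE N | w.2 < ε} ∈ nhds z :=
              (isOpen_lt continuous_snd continuous_const).mem_nhds (show z.2 < ε by linarith)
            filter_upwards [ho] with w hw
            have hw : w.2 < ε := hw
            simp [f, hψ0 w.2 hw.le]
          rw [this.fderiv_eq, ← ofReal_norm]; simp
      rw [hsupp]
      have pt : ∀ z ∈ HS N, ‖fderiv ℝ f z‖ₑ ≤
          ENNReal.ofReal K * (W (a - 1) z * ‖v z - v (S 2 z)‖ₑ) +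
          (W a z * ‖fderiv ℝ v z‖ₑ + 2 * (W a z * ‖fderiv ℝ v (S 2 z)‖ₑ)) := by
        intro z hz
        have hz' : 0 < z.2 := hz
        have d1 : HasFDerivAt (fun z : EE N => ψ z.2)
            (deriv ψ z.2 • ContinuousLinearMap.snd ℝ (Fin N → ℝ) ℝ) z :=
          ((hψ.differentiable one_ne_zero) z.2).hasDerivAt.comp_hasFDerivAt z hasFDerivAt_snd
        have d2 : HasFDerivAt (fun z : EE N => v z - v (S 2 z))
            (fderiv ℝ v z - (fderiv ℝ v (S 2 z)).comp L) z := by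
          refine ((hv.differentiable one_ne_zero) z).hasFDerivAt.sub ?_
          simp_rw [hL]
          exact ((hv.differentiable one_ne_zero) (L z)).hasFDerivAt.comp z L.hasFDerivAt
        have d3 := (d1.mul d2).fderiv
        have hn : ‖fderiv ℝ f z‖ ≤ K * (z.2 ^ (a - 1) * ‖v z - v (S 2 z)‖) +
            (z.2 ^ a * ‖fderiv ℝ v z‖ + 2 * (z.2 ^ a * ‖fderiv ℝ v (S 2 z)‖)) := by
          change ‖fderiv ℝ (fun z : EE N => ψ z.2 * (v z - v (S 2 z))) z‖ ≤ _
          erw [d3]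
          refine (norm_add_le _ _).trans ?_
          rw [norm_smul, norm_smul, norm_smul, Real.norm_eq_abs, Real.norm_eq_abs (deriv ψ z.2)]
          have n1 : ‖fderiv ℝ v z - (fderiv ℝ v (S 2 z)).comp L‖ ≤
              ‖fderiv ℝ v z‖ + ‖fderiv ℝ v (S 2 z)‖ * 2 := by
            refine (norm_sub_le _ _).trans ?_
            gcongr
            refine (ContinuousLinearMap.opNorm_comp_le _ _).trans ?_
            gcongr
          have n2 : ‖ContinuousLinearMap.snd ℝ (Fin N → ℝ) ℝ‖ ≤ 1 :=
            ContinuousLinearMap.norm_snd_le ..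
          have e1 := hψ1 _ hz'
          have e2 := hψ2 _ hz'
          have t1 : |ψ z.2| * ‖fderiv ℝ v z - (fderiv ℝ v (S 2 z)).comp L‖ ≤
              z.2 ^ a * (‖fderiv ℝ v z‖ + ‖fderiv ℝ v (S 2 z)‖ * 2) := by gcongr
          have t2 : ‖v z - v (S 2 z)‖ * (|deriv ψ z.2| * ‖ContinuousLinearMap.snd ℝ (Fin N → ℝ) ℝ‖)
              ≤ ‖v z - v (S 2 z)‖ * (K * z.2 ^ (a - 1) * 1) := by gcongr
          linarith
        rw [← ofReal_norm]
        refine (ENNReal.ofReal_le_ofReal hn).trans (le_of_eq ?_)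
        rw [ENNReal.ofReal_add (by positivity) (by positivity),
          ENNReal.ofReal_add (by positivity) (by positivity), ENNReal.ofReal_mul hK,
          ENNReal.ofReal_mul (by positivity), ENNReal.ofReal_mul (by positivity),
          ENNReal.ofReal_mul (by positivity), ENNReal.ofReal_mul (by positivity)]
        simp only [ofReal_norm, W, ENNReal.ofReal_ofNat]
      refine (setLIntegral_mono' (HS_meas N) pt).trans ?_
      have m1 : Measurable (fun z : EE N => W (a - 1) z * ‖v z - v (S 2 z)‖ₑ) :=
        (W_meas _).mul hD.continuous.enorm.measurable
      have m2 : Measurable (fun z : EE N => W a z * ‖fderiv ℝ v z‖ₑ) := (W_meas _).mul hAm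
      have m3 : Measurable (fun z : EE N => W a z * ‖fderiv ℝ v (S 2 z)‖ₑ) := (W_meas _).mul hSm
      rw [lintegral_add_left (m1.const_mul _), lintegral_add_left m2,
        lintegral_const_mul _ m1, lintegral_const_mul _ m3,
        scaleW (by norm_num : (0:ℝ) < 2) a (fun z => ‖fderiv ℝ v z‖ₑ) hAm, ← hG]
      calc _ ≤ ENNReal.ofReal K * (ENNReal.ofReal (2 ^ |a + 1|) * G) +
            (G + 2 * (ENNReal.ofReal (2 ^ (-a - 1)) * G)) := by
              gcongr; exact hardy a v hv
        _ = B * G := by rw [hB]; ring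
    calc _ ≤ _ := h1
      _ ≤ _ := hs
      _ ≤ M * (B * G) ^ r := by gcongr
      _ = _ := by rw [ENNReal.mul_rpow_of_nonneg _ _ hr0, mul_assoc]
  have hU : HS N = ⋃ k : ℕ, {z : EE N | 2 * (1 / ((k:ℝ) + 1)) ≤ z.2} := by
    ext z
    simp only [HS, mem_ofPred_eq, mem_iUnion]
    constructor
    · intro hz
      obtain ⟨k, hk⟩ := exists_nat_one_div_lt (half_pos hz)
      exact ⟨k, by linarith⟩
    · rintro ⟨k, hk⟩
      exact lt_of_lt_of_le (by positivity) hk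
  rw [hU, setLIntegral_iUnion_of_directed]
  · exact iSup_le fun k => main _ (by positivity)
  · refine (Monotone.directed_le ?_)
    intro j k hjk z hz
    have hz : 2 * (1 / ((j:ℝ) + 1)) ≤ z.2 := hz
    change 2 * (1 / ((k:ℝ) + 1)) ≤ z.2
    refine le_trans ?_ hz
    gcongr

lemma absorb {P X : ENNReal} {k : ℝ} (hk0 : 0 ≤ k) (hk : k < 1) (hP : P ≠ ⊤)
    (h : P ≤ X + ENNReal.ofReal k * P) : P ≤ ENNReal.ofReal (1 - k)⁻¹ * X := by
  have hk1 : 0 < 1 - k := by linarith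
  by_cases hX : X = ⊤
  · rw [hX, ENNReal.mul_top]
    · exact le_top
    · simpa using hk
  lift P to NNReal using hP
  lift X to NNReal using hX
  have h' := ENNReal.toReal_mono (by finiteness) h
  rw [ENNReal.toReal_add (by finiteness) (by finiteness), ENNReal.toReal_mul,
    ENNReal.toReal_ofReal hk0] at h'
  simp only [ENNReal.coe_toReal] at h'
  rw [← ENNReal.toReal_le_toReal (by finiteness) (by finiteness), ENNReal.toReal_mul,
    ENNReal.toReal_ofReal (by positivity)]
  simp only [ENNReal.coe_toReal]
  rw [inv_mul_eq_div, le_div_iff₀ hk1]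
  linarith

lemma L1 {N : ℕ} (hN : 1 ≤ N) {a b p : ℝ} (hp : 1 ≤ p) (hpN : N * p ≤ N + 1)
    (hab : b = a - 1 + ((N:ℝ) + 1) * (1 - 1 / p)) (hb : 0 < b + 1 / p) :
    ∃ C : ENNReal, C ≠ ⊤ ∧ ∀ v : EE N → ℝ, ContDiff ℝ 1 v → HasCompactSupport v →
    (∫⁻ z in HS N, (W b z * ‖v z‖ₑ) ^ p) ^ (1 / p) ≤
      C * ∫⁻ z in HS N, W a z * ‖fderiv ℝ v z‖ₑ := by
  obtain ⟨C2, hC2, hsob⟩ := sobolev hN a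
  set r : ℝ := ((N:ℝ) + 1) / N with hr
  have hN' : (1:ℝ) ≤ N := by exact_mod_cast hN
  have hr0 : 0 ≤ r := by positivity
  have hp0 : 0 < p := by linarith
  set t' : ℝ := N + 1 - N * p with ht'
  set t : ℝ := N * (p - 1) with ht
  have ht'0 : 0 ≤ t' := by linarith
  have ht0 : 0 ≤ t := mul_nonneg (by linarith) (by linarith)
  have htt : t' + t = 1 := by rw [ht, ht']; ring
  have hrt : r * t = (N + 1) * (p - 1) := by rw [hr, ht]; field_simp
  have hsum : t' + r * t = p := by rw [hrt, ht']; ring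
  have hbp : b * p = (a - 1) * t' + a * (r * t) := by
    rw [hab, hrt, ht']; field_simp; ring
  set C1 : ENNReal := ENNReal.ofReal (2 ^ |a + 1|) with hC1
  set k : ℝ := 2 ^ (-(b + 1 / p)) with hk
  have hk0 : 0 ≤ k := by positivity
  have hk1 : k < 1 := Real.rpow_lt_one_of_one_lt_of_neg (by norm_num) (by linarith)
  set X : ENNReal := (C1 ^ t' * C2 ^ t) ^ (1 / p) with hX
  refine ⟨ENNReal.ofReal (1 - k)⁻¹ * X, ?_, fun v hv hvc => ?_⟩
  · refine ENNReal.mul_ne_top (by simp) (ENNReal.rpow_ne_top_of_nonneg (by positivity) ?_)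
    exact ENNReal.mul_ne_top (ENNReal.rpow_ne_top_of_nonneg ht'0 (by simp [hC1]))
      (ENNReal.rpow_ne_top_of_nonneg ht0 hC2)
  set G : ENNReal := ∫⁻ z in HS N, W a z * ‖fderiv ℝ v z‖ₑ with hG
  have hvm : Measurable (fun z => ‖v z‖ₑ) := hv.continuous.enorm.measurable
  have hvSm : Measurable (fun z : EE N => v (S 2 z)) := hv.continuous.measurable.comp (S_meas 2)
  have hDm : Measurable (fun z : EE N => ‖v z - v (S 2 z)‖ₑ) :=
    (hv.continuous.measurable.sub hvSm).enorm
  have hVm : Measurable (fun z : EE N => ‖v (S 2 z)‖ₑ) := hvSm.enorm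
  -- estimate of the difference
  have hDest : (∫⁻ z in HS N, (W b z * ‖v z - v (S 2 z)‖ₑ) ^ p) ^ (1 / p) ≤ X * G := by
    have e : ∫⁻ z in HS N, (W b z * ‖v z - v (S 2 z)‖ₑ) ^ p =
        ∫⁻ z in HS N, (W (a - 1) z * ‖v z - v (S 2 z)‖ₑ) ^ t' *
          ((W a z * ‖v z - v (S 2 z)‖ₑ) ^ r) ^ t := by
      refine setLIntegral_congr_fun (HS_meas N) fun z hz => ?_
      rw [← ENNReal.rpow_mul, ENNReal.mul_rpow_of_nonneg _ _ hp0.le,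
        ENNReal.mul_rpow_of_nonneg _ _ ht'0,
        ENNReal.mul_rpow_of_nonneg _ _ (mul_nonneg hr0 ht0), W_pow _ _ hz, W_pow _ _ hz,
        W_pow _ _ hz, mul_mul_mul_comm, W_mul _ _ hz,
        ← ENNReal.rpow_add_of_nonneg _ _ ht'0 (mul_nonneg hr0 ht0), hsum, hbp]
    have h1 := ENNReal.lintegral_mul_norm_pow_le (μ := volume.restrict (HS N))
      ((W_meas (a - 1)).mul hDm).aemeasurable
      (((W_meas a).mul hDm).pow_const r).aemeasurable ht'0 ht0 htt
    rw [e]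
    have h2 : ∫⁻ z in HS N, (W (a - 1) z * ‖v z - v (S 2 z)‖ₑ) ^ t' *
          ((W a z * ‖v z - v (S 2 z)‖ₑ) ^ r) ^ t ≤ (C1 ^ t' * C2 ^ t) * G ^ p := by
      refine h1.trans ?_
      calc _ ≤ (C1 * G) ^ t' * (C2 * G ^ r) ^ t := by
            gcongr
            · exact hardy a v hv
            · exact hsob v hv hvc
        _ = _ := by
            rw [ENNReal.mul_rpow_of_nonneg _ _ ht'0, ENNReal.mul_rpow_of_nonneg _ _ ht0,
              ← ENNReal.rpow_mul, mul_mul_mul_comm,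
              ← ENNReal.rpow_add_of_nonneg _ _ ht'0 (mul_nonneg hr0 ht0), hsum]
    refine (ENNReal.rpow_le_rpow h2 (by positivity)).trans (le_of_eq ?_)
    rw [ENNReal.mul_rpow_of_nonneg _ _ (by positivity), ← ENNReal.rpow_mul,
      mul_one_div_cancel hp0.ne', ENNReal.rpow_one]
  -- the scaled part
  have hW : ∀ w : EE N → ENNReal, ∫⁻ z in HS N, (W b z * w z) ^ p =
      ∫⁻ z in HS N, W (b * p) z * w z ^ p := by
    intro w
    refine setLIntegral_congr_fun (HS_meas N) fun z hz => ?_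
    rw [ENNReal.mul_rpow_of_nonneg _ _ hp0.le, W_pow _ _ hz]
  have hSc : (∫⁻ z in HS N, (W b z * ‖v (S 2 z)‖ₑ) ^ p) ^ (1 / p) =
      ENNReal.ofReal k * (∫⁻ z in HS N, (W b z * ‖v z‖ₑ) ^ p) ^ (1 / p) := by
    rw [hW (fun z => ‖v (S 2 z)‖ₑ), hW (fun z => ‖v z‖ₑ),
      scaleW (by norm_num : (0:ℝ) < 2) (b * p) (fun z => ‖v z‖ₑ ^ p) (hvm.pow_const p),
      ENNReal.mul_rpow_of_nonneg _ _ (by positivity),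
      ENNReal.ofReal_rpow_of_pos (by positivity), ← Real.rpow_mul (by norm_num)]
    congr 3
    field_simp; ring
  have hfin : (∫⁻ z in HS N, (W b z * ‖v z‖ₑ) ^ p) ^ (1 / p) ≠ ⊤ := by
    refine ENNReal.rpow_ne_top_of_nonneg (by positivity) ?_
    rw [hW (fun z => ‖v z‖ₑ)]
    obtain ⟨B, hB⟩ := hv.continuous.bounded_above_of_compact_support hvc
    obtain ⟨R, hR⟩ := hvc.isCompact.isBounded.exists_norm_le
    refine (W_fin (M := (ENNReal.ofReal B) ^ p) (R := R) ?_ _ ?_ ?_ ?_).ne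
    · have : 0 < (b + 1 / p) * p := by positivity
      have e : (b + 1 / p) * p = b * p + 1 := by field_simp
      linarith
    · exact ENNReal.rpow_ne_top_of_nonneg hp0.le (by simp)
    · intro z
      rw [← ofReal_norm]
      gcongr
      exact hB z
    · intro z hz
      have : v z = 0 := by
        by_contra h
        exact absurd (hR z (subset_tsupport _ h)) (not_le.2 hz)
      simp [this, hp0]
  have hmink := ENNReal.lintegral_Lp_add_le (μ := volume.restrict (HS N)) (p := p)
    (f := fun z => W b z * ‖v z - v (S 2 z)‖ₑ) (g := fun z => W b z * ‖v (S 2 z)‖ₑ)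
    ((W_meas b).mul hDm).aemeasurable ((W_meas b).mul hVm).aemeasurable hp
  rw [mul_assoc]
  refine absorb hk0 hk1 hfin ?_
  rw [← hSc]
  refine le_trans ?_ (hmink.trans (by gcongr))
  gcongr with z
  simp only [Pi.add_apply]
  rw [← mul_add]
  gcongr
  calc ‖v z‖ₑ = ‖(v z - v (S 2 z)) + v (S 2 z)‖ₑ := by congr 1; ring
    _ ≤ _ := enorm_add_le _ _

lemma fderiv_le_grad {N : ℕ} (u : EE N → ℝ) (z : EE N) :
    ‖fderiv ℝ u z‖ ≤ ((N:ℝ) + 1) * gradNorm u z := by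
  have hX : ∀ i, |pX u i z| ≤ gradNorm u z := by
    intro i
    refine Real.abs_le_sqrt ?_
    have := Finset.single_le_sum (f := fun i => pX u i z ^ 2) (fun i _ => sq_nonneg _)
      (Finset.mem_univ i)
    have h2 := sq_nonneg (pY u z)
    linarith
  have hY : |pY u z| ≤ gradNorm u z := by
    refine Real.abs_le_sqrt ?_
    have : 0 ≤ ∑ i, pX u i z ^ 2 := Finset.sum_nonneg fun i _ => sq_nonneg _
    linarith
  have hg : 0 ≤ gradNorm u z := Real.sqrt_nonneg _
  refine ContinuousLinearMap.opNorm_le_bound _ (by positivity) fun w => ?_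
  have hw : w = (∑ i, w.1 i • ((Pi.single i (1:ℝ) : Fin N → ℝ), (0:ℝ))) +
      w.2 • ((0 : Fin N → ℝ), (1:ℝ)) := by
    refine Prod.ext ?_ ?_
    · simp only [Prod.fst_add, Prod.fst_sum, Prod.smul_fst, smul_zero, add_zero]
      ext j
      simp [Finset.sum_apply, Pi.single_apply]
    · simp [Prod.snd_sum]
  have e : fderiv ℝ u z w = (∑ i, w.1 i * pX u i z) + w.2 * pY u z := by
    conv_lhs => rw [hw]
    rw [map_add, map_sum, map_smul]
    simp only [map_smul, smul_eq_mul]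
    rfl
  rw [e, Real.norm_eq_abs]
  refine (abs_add_le _ _).trans ?_
  have h1 : |∑ i, w.1 i * pX u i z| ≤ ∑ _i : Fin N, ‖w‖ * gradNorm u z := by
    refine (Finset.abs_sum_le_sum_abs _ _).trans (Finset.sum_le_sum fun i _ => ?_)
    rw [abs_mul]
    have : |w.1 i| ≤ ‖w‖ := (norm_le_pi_norm w.1 i).trans (norm_fst_le w)
    exact mul_le_mul this (hX i) (abs_nonneg _) (norm_nonneg _)
  have h2 : |w.2 * pY u z| ≤ ‖w‖ * gradNorm u z := by
    rw [abs_mul]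
    have : |w.2| ≤ ‖w‖ := norm_snd_le w
    exact mul_le_mul this hY (abs_nonneg _) (norm_nonneg _)
  simp only [Finset.sum_const, Finset.card_univ, Fintype.card_fin, nsmul_eq_mul] at h1
  linarith

/-- weighted `L²` Sobolev inequality of Maz'ya type: if
`2 ≤ q ≤ 2(N+1)/(N−1)` (only `2 ≤ q` when `N = 1`), `β + 1/q > 0` and
`β = α − 1 + (N+1)(1/2 − 1/q)`, then
`‖y^β u‖_{L^q} ≤ C ‖y^α ∇u‖_{L²}` for smooth compactly supported `u` on the
closed half-space. -/
theorem stmt_3 (N : ℕ) (hN : 1 ≤ N) (q β α : ℝ)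
    (hq1 : 2 ≤ q) (hq2 : 1 < N → q ≤ 2 * ((N : ℝ) + 1) / ((N : ℝ) - 1))
    (hβ : β + 1 / q > 0)
    (hβα : β = α - 1 + ((N : ℝ) + 1) * (1 / 2 - 1 / q)) :
    ∃ C > 0, ∀ u : ((Fin N → ℝ) × ℝ) → ℝ, ContDiff ℝ (⊤ : ℕ∞) u → HasCompactSupport u →
      (∫ z in HS N, z.2 ^ (β * q) * |u z| ^ q) ^ (1 / q) ≤
        C * (∫ z in HS N, z.2 ^ (2 * α) * gradNorm u z ^ 2) ^ (1 / 2 : ℝ) := by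
  have hN' : (1:ℝ) ≤ N := by exact_mod_cast hN
  have hq0 : 0 < q := by linarith
  have hqN : q * ((N:ℝ) - 1) ≤ 2 * ((N:ℝ) + 1) := by
    rcases hN.eq_or_lt with h | h
    · rw [← h]; norm_num
    · have h1 : (1:ℝ) < N := by exact_mod_cast h
      exact (le_div_iff₀ (by linarith)).1 (hq2 h)
  have hα : -1 < 2 * α := by
    have h1 : α = β + 1 / q - N / 2 + 1 / 2 + N / q := by
      rw [hβα]; field_simp; ring
    have h2 : ((N:ℝ) - 2) / 2 ≤ N / q := by
      rw [div_le_div_iff₀ (by norm_num) hq0]; nlinarith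
    linarith
  set s : ℝ := 1 + q / 2 with hs
  have hs1 : 1 < s := by linarith
  set p : ℝ := 2 * q / (q + 2) with hp
  have hp1 : 1 ≤ p := by rw [hp, le_div_iff₀ (by linarith)]; linarith
  have hp0 : 0 < p := by linarith
  have hsp : s * p = q := by rw [hs, hp]; field_simp; ring
  have hinvp : 1 / p = 1 / 2 + 1 / q := by rw [hp]; field_simp
  set a : ℝ := α + β * q / 2 with ha
  obtain ⟨C, hC, hL1⟩ := L1 (N := N) hN (a := a) (b := β * s) (p := p) hp1
    (by rw [hp, mul_div_assoc', div_le_iff₀ (by linarith)]; nlinarith)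
    (by
      rw [hinvp, hs, ha]
      have : β * (1 + q / 2) = β + β * q / 2 := by ring
      rw [this]; linarith)
    (by
      have : β * s + 1 / p = s * (β + 1 / q) := by rw [hinvp, hs]; field_simp; ring
      rw [this]; exact mul_pos (by linarith) hβ)
  set C' : ENNReal := C * ENNReal.ofReal s * ENNReal.ofReal ((N:ℝ) + 1) with hC'
  have hC'top : C' ≠ ⊤ := by
    refine ENNReal.mul_ne_top (ENNReal.mul_ne_top hC (by simp)) (by simp)
  refine ⟨C'.toReal + 1, by positivity, fun u hu huc => ?_⟩
  have hu1 : ContDiff ℝ 1 u := hu.of_le (by exact_mod_cast le_top)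
  have hud : Differentiable ℝ u := hu1.differentiable one_ne_zero
  have hA : Continuous (fun z => fderiv ℝ u z) := hu1.continuous_fderiv one_ne_zero
  have hgc : Continuous (fun z => gradNorm u z) := by
    unfold gradNorm pX pY
    refine Real.continuous_sqrt.comp ?_
    refine Continuous.add (continuous_finsetSum _ fun i _ => ?_) ?_
    · exact (hA.clm_apply continuous_const).pow 2
    · exact (hA.clm_apply continuous_const).pow 2
  obtain ⟨R, hR⟩ := huc.isCompact.isBounded.exists_norm_le
  have hR' : ∀ z, R < ‖z‖ → z ∉ tsupport u := fun z hz h =>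
    absurd (hR z h) (not_le.2 hz)
  have hu0 : ∀ z, R < ‖z‖ → u z = 0 := fun z hz => image_eq_zero_of_notMem_tsupport (hR' z hz)
  have hg0 : ∀ z, R < ‖z‖ → gradNorm u z = 0 := by
    intro z hz
    have : fderiv ℝ u z = 0 := by
      by_contra h
      exact hR' z hz (support_fderiv_subset ℝ h)
    simp [gradNorm, pX, pY, this]
  have hgcs : HasCompactSupport (fun z => gradNorm u z) :=
    HasCompactSupport.intro (isCompact_closedBall (0 : EE N) R) fun z hz =>
      hg0 z (by simpa using hz)
  set I : ENNReal := ∫⁻ z in HS N, W (β * q) z * ‖u z‖ₑ ^ q with hI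
  set E : ENNReal := ∫⁻ z in HS N, W (2 * α) z * ENNReal.ofReal (gradNorm u z ^ 2) with hE
  set E' : ENNReal := ∫⁻ z in HS N, W (2 * α) z * ‖fderiv ℝ u z‖ₑ ^ (2:ℝ) with hE'
  have hItop : I ≠ ⊤ := by
    obtain ⟨B, hB⟩ := hu1.continuous.bounded_above_of_compact_support huc
    refine (W_fin (M := (ENNReal.ofReal B) ^ q) (R := R) ?_ _ ?_ ?_ ?_).ne
    · have h : 0 < (β + 1 / q) * q := mul_pos hβ hq0
      have e : (β + 1 / q) * q = β * q + 1 := by field_simp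
      linarith
    · exact ENNReal.rpow_ne_top_of_nonneg hq0.le (by simp)
    · intro z
      rw [← ofReal_norm]
      gcongr
      exact hB z
    · intro z hz
      simp [hu0 z hz, hq0]
  have hEtop : E ≠ ⊤ := by
    obtain ⟨B, hB⟩ := hgc.bounded_above_of_compact_support hgcs
    refine (W_fin (M := ENNReal.ofReal (B ^ 2)) (R := R) hα _ (by simp) ?_ ?_).ne
    · intro z
      refine ENNReal.ofReal_le_ofReal ?_
      exact pow_le_pow_left₀ (Real.sqrt_nonneg _) ((le_abs_self _).trans (hB z)) 2
    · intro z hz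
      simp [hg0 z hz]
  have hEE' : E' ^ (1 / 2 : ℝ) ≤ ENNReal.ofReal ((N:ℝ) + 1) * E ^ (1 / 2 : ℝ) := by
    have h1 : E' ≤ ENNReal.ofReal ((N:ℝ) + 1) ^ (2:ℝ) * E := by
      have m0 : Measurable (fun z => W (2 * α) z * ENNReal.ofReal (gradNorm u z ^ 2)) :=
        (W_meas _).mul (hgc.pow 2).measurable.ennreal_ofReal
      rw [hE, ← lintegral_const_mul _ m0]
      refine lintegral_mono fun z => ?_
      rw [mul_left_comm]
      refine mul_le_mul_right ?_ _
      have hg : 0 ≤ gradNorm u z := Real.sqrt_nonneg _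
      have hn := fderiv_le_grad u z
      rw [← ofReal_norm, ENNReal.rpow_two, ENNReal.rpow_two, ENNReal.ofReal_pow hg, ← mul_pow,
        ← ENNReal.ofReal_mul (by positivity)]
      gcongr
    refine (ENNReal.rpow_le_rpow h1 (by norm_num)).trans (le_of_eq ?_)
    rw [ENNReal.mul_rpow_of_nonneg _ _ (by norm_num), ← ENNReal.rpow_mul]
    norm_num
  have key : I ^ (1 / q) ≤ C' * E ^ (1 / 2 : ℝ) := by
    have hv : ContDiff ℝ 1 (fun z => ‖u z‖ ^ s) := hu1.norm_rpow hs1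
    have hvc : HasCompactSupport (fun z => ‖u z‖ ^ s) :=
      HasCompactSupport.intro (isCompact_closedBall (0 : EE N) R) fun z hz => by
        have : R < ‖z‖ := by simpa using hz
        simp [hu0 z this, (by linarith : s ≠ 0)]
    have h1 := hL1 _ hv hvc
    have e1 : ∫⁻ z in HS N, (W (β * s) z * ‖‖u z‖ ^ s‖ₑ) ^ p = I := by
      refine setLIntegral_congr_fun (HS_meas N) fun z hz => ?_
      have : ‖‖u z‖ ^ s‖ₑ = ‖u z‖ₑ ^ s := by
        rw [Real.enorm_eq_ofReal (by positivity), ← ofReal_norm (u z),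
          ENNReal.ofReal_rpow_of_nonneg (norm_nonneg _) (by linarith)]
      rw [this, ENNReal.mul_rpow_of_nonneg _ _ hp0.le, W_pow _ _ hz, ← ENNReal.rpow_mul,
        mul_assoc, hsp]
    rw [e1] at h1
    have e2 : ∫⁻ z in HS N, W a z * ‖fderiv ℝ (fun z => ‖u z‖ ^ s) z‖ₑ ≤
        ENNReal.ofReal s * (I ^ (1 / 2 : ℝ) * E' ^ (1 / 2 : ℝ)) := by
      have m1 : Measurable (fun z => W (β * q) z * ‖u z‖ₑ ^ q) :=
        (W_meas _).mul (hu1.continuous.enorm.measurable.pow_const q)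
      have m2 : Measurable (fun z => W (2 * α) z * ‖fderiv ℝ u z‖ₑ ^ (2:ℝ)) :=
        (W_meas _).mul (hA.enorm.measurable.pow_const _)
      have hh := ENNReal.lintegral_mul_norm_pow_le (μ := volume.restrict (HS N))
        m1.aemeasurable m2.aemeasurable (p := 1 / 2) (q := 1 / 2) (by norm_num) (by norm_num)
        (by norm_num)
      refine le_trans ?_ (mul_le_mul_right hh _)
      have m3 : Measurable (fun z => (W (β * q) z * ‖u z‖ₑ ^ q) ^ (1 / 2 : ℝ) *
          (W (2 * α) z * ‖fderiv ℝ u z‖ₑ ^ (2:ℝ)) ^ (1 / 2 : ℝ)) :=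
        (m1.pow_const _).mul (m2.pow_const _)
      rw [← lintegral_const_mul _ m3]
      refine setLIntegral_mono' (HS_meas N) fun z hz => ?_
      have hn := norm_fderiv_norm_rpow_le hud (x := z) hs1
      have hn' : ‖fderiv ℝ (fun z => ‖u z‖ ^ s) z‖ₑ ≤
          ENNReal.ofReal s * (‖u z‖ₑ ^ (q / 2) * ‖fderiv ℝ u z‖ₑ) := by
        rw [← ofReal_norm, ← ofReal_norm (u z), ← ofReal_norm (fderiv ℝ u z),
          ENNReal.ofReal_rpow_of_nonneg (norm_nonneg _) (by positivity),
          ← ENNReal.ofReal_mul (by positivity), ← ENNReal.ofReal_mul (by linarith)]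
        refine ENNReal.ofReal_le_ofReal (hn.trans (le_of_eq ?_))
        have : s - 1 = q / 2 := by rw [hs]; ring
        rw [this, mul_assoc]
      refine (mul_le_mul_right hn' _).trans (le_of_eq ?_)
      rw [mul_left_comm]
      congr 1
      rw [ENNReal.mul_rpow_of_nonneg _ _ (by norm_num),
        ENNReal.mul_rpow_of_nonneg _ _ (by norm_num), W_pow _ _ hz, W_pow _ _ hz,
        ← ENNReal.rpow_mul, ← ENNReal.rpow_mul, mul_mul_mul_comm, W_mul _ _ hz]
      have x1 : β * q * (1 / 2) + 2 * α * (1 / 2) = a := by rw [ha]; ring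
      have x2 : q * (1 / 2) = q / 2 := by ring
      have x3 : (2:ℝ) * (1 / 2) = 1 := by norm_num
      rw [x1, x2, x3, ENNReal.rpow_one]
    by_cases hI0 : I = 0
    · rw [hI0, ENNReal.zero_rpow_of_pos (by positivity)]; exact zero_le
    have h3 : I ^ (1 / 2 : ℝ) * I ^ (1 / q) ≤ I ^ (1 / 2 : ℝ) * (C' * E ^ (1 / 2 : ℝ)) := by
      rw [← ENNReal.rpow_add _ _ hI0 hItop, ← hinvp]
      calc _ ≤ C * (ENNReal.ofReal s * (I ^ (1 / 2 : ℝ) * E' ^ (1 / 2 : ℝ))) :=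
            h1.trans (mul_le_mul_right e2 _)
        _ ≤ C * (ENNReal.ofReal s * (I ^ (1 / 2 : ℝ) *
            (ENNReal.ofReal ((N:ℝ) + 1) * E ^ (1 / 2 : ℝ)))) := by gcongr
        _ = _ := by rw [hC']; ring
    refine (ENNReal.mul_le_mul_iff_right ?_ ?_).1 h3
    · simp [hI0, hItop]
    · exact ENNReal.rpow_ne_top_of_nonneg (by norm_num) hItop
  have r1 : ∫ z in HS N, z.2 ^ (β * q) * |u z| ^ q = I.toReal := by
    rw [integral_eq_lintegral_of_nonneg_ae]
    · congr 1
      refine setLIntegral_congr_fun (HS_meas N) fun z hz => ?_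
      have hz : 0 < z.2 := hz
      rw [ENNReal.ofReal_mul (by positivity), W, ← ofReal_norm, Real.norm_eq_abs,
        ENNReal.ofReal_rpow_of_nonneg (abs_nonneg _) hq0.le]
    · refine (ae_restrict_iff' (HS_meas N)).2 (Filter.Eventually.of_forall fun z hz => ?_)
      have hz : 0 < z.2 := hz
      simp only [Pi.zero_apply]
      positivity
    · refine Measurable.aestronglyMeasurable ?_
      exact (measurable_snd.pow_const _).mul
        ((continuous_abs.comp hu1.continuous).measurable.pow_const q)
  have r2 : ∫ z in HS N, z.2 ^ (2 * α) * gradNorm u z ^ 2 = E.toReal := by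
    rw [integral_eq_lintegral_of_nonneg_ae]
    · congr 1
      refine setLIntegral_congr_fun (HS_meas N) fun z hz => ?_
      have hz : 0 < z.2 := hz
      rw [ENNReal.ofReal_mul (by positivity), W]
    · refine (ae_restrict_iff' (HS_meas N)).2 (Filter.Eventually.of_forall fun z hz => ?_)
      have hz : 0 < z.2 := hz
      simp only [Pi.zero_apply]
      positivity
    · refine Measurable.aestronglyMeasurable ?_
      exact (measurable_snd.pow_const _).mul (hgc.pow 2).measurable
  rw [r1, r2, ENNReal.toReal_rpow, ENNReal.toReal_rpow]
  have hfin : C' * E ^ (1 / 2 : ℝ) ≠ ⊤ :=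
    ENNReal.mul_ne_top hC'top (ENNReal.rpow_ne_top_of_nonneg (by norm_num) hEtop)
  have h := ENNReal.toReal_mono hfin key
  rw [ENNReal.toReal_mul] at h
  have h0 : 0 ≤ (E ^ (1 / 2 : ℝ)).toReal := ENNReal.toReal_nonneg
  linarith
end
end
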